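/- (Anisotropic Alexandrov theorem.) Let H be a norm of class I_p with p > 1 on ℝ^N, and let ∂Ω be a compact connected hypersurface without boundary, embedded in ℝ^N and of class C², bounding the domain Ω. If the anisotropic mean curvature M_{∂Ω} is constant on ∂Ω, then Ω is Wulff shape of H. -/

import Mathlib

open MeasureTheory Filter Set
open scoped Topology RealInnerProductSpace NNReal

noncomputable section

abbrev Euc (N : ℕ) := EuclideanSpace ℝ (Fin N)

variable {N : ℕ}

/-- The partial derivative of `f` in the `i`-th coordinate direction. -/
def pd (i : Fin N) (f : Euc N → ℝ) (x : Euc N) : ℝ :=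
  fderiv ℝ f x (EuclideanSpace.single i 1)

/-- The Hessian matrix of `f` at `x`. -/
def hessM (f : Euc N → ℝ) (x : Euc N) : Matrix (Fin N) (Fin N) ℝ :=
  Matrix.of fun i j => pd i (pd j f) x

/-- Interpret a plain function `Fin N → ℝ` as a point of Euclidean space. -/
def toEuc {N : ℕ} (f : Fin N → ℝ) : Euc N := (WithLp.equiv 2 (Fin N → ℝ)).symm f

/-- The divergence of a vector field. -/
def divVF (X : Euc N → Euc N) (x : Euc N) : ℝ := ∑ i, pd i (fun y => X y i) x

/-- The quadratic form associated to a matrix. -/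
def qForm (A : Matrix (Fin N) (Fin N) ℝ) (ζ : Euc N) : ℝ := ∑ i, ∑ j, A i j * ζ i * ζ j

/-- Local `α`-Hölder continuity of `g` on `s` (uniform on compact subsets). -/
def LocHolderOn {X Y : Type*} [NormedAddCommGroup X] [NormedAddCommGroup Y]
    (α : ℝ) (g : X → Y) (s : Set X) : Prop :=
  ∀ K : Set X, K ⊆ s → IsCompact K → ∃ C : ℝ, ∀ x ∈ K, ∀ y ∈ K, ‖g x - g y‖ ≤ C * ‖x - y‖ ^ α

/-- The dual norm `H₀(x) = sup_{ξ ≠ 0} ⟨x, ξ⟩ / H(ξ)`. -/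
def dualNorm (H : Euc N → ℝ) (x : Euc N) : ℝ :=
  ⨆ ξ : {ξ : Euc N // ξ ≠ 0}, ⟪x, (ξ : Euc N)⟫ / H ξ

/-- `V = H^p / p`. -/
def Vfun (H : Euc N → ℝ) (p : ℝ) : Euc N → ℝ := fun ξ => H ξ ^ p / p

/-- `H` is a norm of class `I_p`: a norm which is `C^{2,α}` away from the origin, for some
`α ∈ (0,1)`, such that `V = H^p/p` is `C²` away from the origin with Hessian having positive
eigenvalues uniformly bounded away from `0` on the unit sphere. -/
structure IsIpNorm (p : ℝ) (H : Euc N → ℝ) : Prop where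
  convex : ConvexOn ℝ Set.univ H
  homog : ∀ (t : ℝ) (ξ : Euc N), H (t • ξ) = |t| * H ξ
  pos : ∀ ξ : Euc N, ξ ≠ 0 → 0 < H ξ
  smooth : ContDiffOn ℝ 2 H {(0 : Euc N)}ᶜ
  holder : ∃ α ∈ Set.Ioo (0:ℝ) 1,
    LocHolderOn α (iteratedFDerivWithin ℝ 2 H {(0 : Euc N)}ᶜ) {(0 : Euc N)}ᶜ
  Vsmooth : ContDiffOn ℝ 2 (Vfun H p) {(0 : Euc N)}ᶜ
  hessV_pos : ∃ c > 0, ∀ ξ : Euc N, ‖ξ‖ = 1 → ∀ ζ : Euc N,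
    c * ‖ζ‖ ^ 2 ≤ qForm (hessM (Vfun H p) ξ) ζ

/-- `Ω` is, up to a translation, the Wulff shape `B_{H₀}(r)` of `H` for some `r > 0`. -/
def IsWulffShape (H : Euc N → ℝ) (Ω : Set (Euc N)) : Prop :=
  ∃ (x₀ : Euc N) (r : ℝ), 0 < r ∧ Ω = {x | dualNorm H (x - x₀) < r}

/-- An open set with boundary of class `C^{2,α}`, described by a `C^{2,α}` defining function. -/
def IsC2alphaDomain (Ω : Set (Euc N)) : Prop :=
  IsOpen Ω ∧ ∃ f : Euc N → ℝ, ContDiff ℝ 2 f ∧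
    (∃ α ∈ Set.Ioo (0:ℝ) 1, LocHolderOn α (iteratedFDeriv ℝ 2 f) (Set.univ : Set (Euc N))) ∧
    Ω = {x | f x < 0} ∧ frontier Ω = {x | f x = 0} ∧
    ∀ x ∈ frontier Ω, gradient f x ≠ 0

/-- Weak solution of `Δ_p^H u = -1` in `Ω`, `u = 0` on `∂Ω`. -/
structure IsInteriorSol (H : Euc N → ℝ) (p : ℝ) (Ω : Set (Euc N)) (u : Euc N → ℝ) : Prop where
  contOn : ContinuousOn u (closure Ω)
  diff : ∀ x ∈ Ω, DifferentiableAt ℝ u x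
  bdry : ∀ x ∈ frontier Ω, u x = 0
  int_u : IntegrableOn u Ω
  int_grad : IntegrableOn (fun x => H (gradient u x) ^ p) Ω
  weak : ∀ φ : Euc N → ℝ, ContDiff ℝ 1 φ → HasCompactSupport φ → tsupport φ ⊆ Ω →
    (∫ x in Ω, H (gradient u x) ^ (p - 1) * ⟪gradient H (gradient u x), gradient φ x⟫)
      = ∫ x in Ω, φ x

/-- Solution of the exterior problem: `Δ_p^H u = 0` weakly in `ℝ^N ∖ cl Ω`, `u = 1` on `∂Ω`,
`u → 0` at infinity. -/
structure IsExteriorSol (H : Euc N → ℝ) (p : ℝ) (Ω : Set (Euc N)) (u : Euc N → ℝ) : Prop where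
  contOn : ContinuousOn u Ωᶜ
  diff : ∀ x ∈ (closure Ω)ᶜ, DifferentiableAt ℝ u x
  bdry : ∀ x ∈ frontier Ω, u x = 1
  decay : Tendsto u (cocompact (Euc N)) (𝓝 0)
  weak : ∀ φ : Euc N → ℝ, ContDiff ℝ 1 φ → HasCompactSupport φ → tsupport φ ⊆ (closure Ω)ᶜ →
    (∫ x in (closure Ω)ᶜ,
      H (gradient u x) ^ (p - 1) * ⟪gradient H (gradient u x), gradient φ x⟫) = 0

/-- The inward unit normal field associated to a defining function `f` (with `Ω = {f < 0}`). -/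
def inwardField (f : Euc N → ℝ) (x : Euc N) : Euc N := -(‖gradient f x‖)⁻¹ • gradient f x

/-- `ν` is the inward unit normal of `Ω` and `M` its anisotropic mean curvature
`M = -div(∇_ξ H(ν))`, computed via a `C²` defining function. -/
def IsNormalCurv (H : Euc N → ℝ) (Ω : Set (Euc N)) (ν : Euc N → Euc N) (M : Euc N → ℝ) : Prop :=
  ∃ f : Euc N → ℝ, ContDiff ℝ 2 f ∧ Ω = {x | f x < 0} ∧ frontier Ω = {x | f x = 0} ∧
    (∀ x ∈ frontier Ω, gradient f x ≠ 0) ∧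
    (∀ x ∈ frontier Ω, ν x = inwardField f x) ∧
    (∀ x ∈ frontier Ω, M x = - divVF (fun y => gradient H (inwardField f y)) x)

/-- `ν` is the inward unit normal field of `Ω`, computed via a `C²` defining function. -/
def IsInwardNormal (Ω : Set (Euc N)) (ν : Euc N → Euc N) : Prop :=
  ∃ f : Euc N → ℝ, ContDiff ℝ 2 f ∧ Ω = {x | f x < 0} ∧ frontier Ω = {x | f x = 0} ∧
    (∀ x ∈ frontier Ω, gradient f x ≠ 0) ∧
    ∀ x ∈ frontier Ω, ν x = inwardField f x

/-- Second elementary symmetric function of a matrix. -/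
def S2 (A : Matrix (Fin N) (Fin N) ℝ) : ℝ := ((Matrix.trace A) ^ 2 - Matrix.trace (A * A)) / 2

/-- `S²_{ij}(A) = -a_{ji} + δ_{ij} Tr A`. -/
def S2ij (A : Matrix (Fin N) (Fin N) ℝ) (i j : Fin N) : ℝ :=
  -A j i + (if i = j then Matrix.trace A else 0)

/-- The matrix `W = ∇²_ξ V(Dv) D²v`. -/
def Wmat (H : Euc N → ℝ) (p : ℝ) (v : Euc N → ℝ) (x : Euc N) : Matrix (Fin N) (Fin N) ℝ :=
  hessM (Vfun H p) (gradient v x) * hessM v x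

/-- `G` is the weak (distributional) Jacobian matrix of the vector field `Z` on `Ω`, with both
`Z` and `G` square-integrable (i.e. `Z ∈ W^{1,2}(Ω)` with Jacobian `G`). -/
def IsWeakJacobianOn (Z : Euc N → Euc N) (G : Euc N → Matrix (Fin N) (Fin N) ℝ)
    (Ω : Set (Euc N)) : Prop :=
  IntegrableOn (fun x => ∑ i, (Z x i) ^ 2) Ω ∧
  IntegrableOn (fun x => ∑ i, ∑ j, (G x i j) ^ 2) Ω ∧
  ∀ (i j : Fin N) (φ : Euc N → ℝ), ContDiff ℝ 1 φ → HasCompactSupport φ → tsupport φ ⊆ Ω →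
    (∫ x in Ω, Z x i * pd j φ x) = - ∫ x in Ω, G x i j * φ x

/-- The vector field `Z` belongs to `W^{1,2}(Ω)`. -/
def MemW12 (Z : Euc N → Euc N) (Ω : Set (Euc N)) : Prop := ∃ G, IsWeakJacobianOn Z G Ω


/-- The anisotropic `p`-capacity of `Ω`. -/
def pCapacity (H : Euc N → ℝ) (p : ℝ) (Ω : Set (Euc N)) : ℝ :=
  sInf {r : ℝ | ∃ φ : Euc N → ℝ, ContDiff ℝ (⊤ : ℕ∞) φ ∧ HasCompactSupport φ ∧
    (∀ x ∈ Ω, 1 ≤ φ x) ∧ r = (1 / p) * ∫ x, H (gradient φ x) ^ p}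

/-- The `(N-1)`-dimensional Hausdorff (surface) measure on `ℝ^N`. -/
def surf (N : ℕ) : Measure (Euc N) := Measure.hausdorffMeasure ((N : ℝ) - 1)

end

noncomputable section
open MeasureTheory Filter Set
open scoped Topology RealInnerProductSpace NNReal

section

variable {N : ℕ} {p : ℝ} {H : Euc N → ℝ}

namespace IsIpNorm

lemma map_zero (hH : IsIpNorm p H) : H 0 = 0 := by
  simpa using hH.homog 0 0

lemma map_neg (hH : IsIpNorm p H) (x : Euc N) : H (-x) = H x := by
  simpa using hH.homog (-1) x

lemma map_smul_of_pos (hH : IsIpNorm p H) {t : ℝ} (ht : 0 < t) (x : Euc N) :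
    H (t • x) = t * H x := by
  rw [hH.homog, abs_of_pos ht]

lemma nonneg (hH : IsIpNorm p H) (x : Euc N) : 0 ≤ H x := by
  rcases eq_or_ne x 0 with rfl | h
  · exact hH.map_zero.ge
  · exact (hH.pos x h).le

lemma add_le (hH : IsIpNorm p H) (x y : Euc N) : H (x + y) ≤ H x + H y := by
  have h := hH.convex.2 (mem_univ ((2 : ℝ) • x)) (mem_univ ((2 : ℝ) • y))
    (by norm_num : (0 : ℝ) ≤ 1 / 2) (by norm_num : (0 : ℝ) ≤ 1 / 2) (by norm_num)
  rw [smul_smul, smul_smul, hH.homog, hH.homog] at h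
  norm_num at h
  linarith

lemma continuous (hH : IsIpNorm p H) : Continuous H :=
  continuousOn_univ.1 (hH.convex.continuousOn isOpen_univ)

lemma exists_lower (hH : IsIpNorm p H) : ∃ m > 0, ∀ x, m * ‖x‖ ≤ H x := by
  rcases (Metric.sphere (0 : Euc N) 1).eq_empty_or_nonempty with he | hne
  · refine ⟨1, one_pos, fun x => ?_⟩
    have hx : x = 0 := by
      by_contra hx
      have : (‖x‖⁻¹ • x) ∈ Metric.sphere (0 : Euc N) 1 := by
        simp [norm_smul, hx]
      simp [he] at this
    simp [hx, hH.map_zero]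
  · obtain ⟨z, hz, hmin⟩ := (isCompact_sphere (0 : Euc N) 1).exists_isMinOn hne
      hH.continuous.continuousOn
    have hz0 : z ≠ 0 := by rintro rfl; simp at hz
    refine ⟨H z, hH.pos z hz0, fun x => ?_⟩
    rcases eq_or_ne x 0 with rfl | hx
    · simp [hH.map_zero]
    have hx' : 0 < ‖x‖ := norm_pos_iff.2 hx
    have h1 : H z ≤ H (‖x‖⁻¹ • x) := hmin (by simp [norm_smul, hx])
    rw [hH.map_smul_of_pos (inv_pos.2 hx')] at h1
    calc H z * ‖x‖ ≤ (‖x‖⁻¹ * H x) * ‖x‖ := by gcongr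
      _ = H x := by field_simp

lemma exists_upper (hH : IsIpNorm p H) : ∃ C > 0, ∀ x, H x ≤ C * ‖x‖ := by
  obtain ⟨C, hC⟩ := (isCompact_sphere (0 : Euc N) 1).exists_bound_of_continuousOn
    hH.continuous.continuousOn
  refine ⟨max C 1, by positivity, fun x => ?_⟩
  rcases eq_or_ne x 0 with rfl | hx
  · simp [hH.map_zero]
  have hx' : 0 < ‖x‖ := norm_pos_iff.2 hx
  have h1 := hC (‖x‖⁻¹ • x) (by simp [norm_smul, hx])
  rw [hH.map_smul_of_pos (inv_pos.2 hx')] at h1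
  have h2 := (le_abs_self _).trans (h1.trans (le_max_left C 1))
  calc H x = (‖x‖⁻¹ * H x) * ‖x‖ := by field_simp
    _ ≤ _ := by gcongr

/-! ### The dual norm -/

lemma dual_bddAbove (hH : IsIpNorm p H) (x : Euc N) :
    BddAbove (range fun ξ : {ξ : Euc N // ξ ≠ 0} => ⟪x, (ξ : Euc N)⟫ / H ξ) := by
  obtain ⟨m, hm, hmH⟩ := hH.exists_lower
  refine ⟨‖x‖ / m, ?_⟩
  rintro _ ⟨⟨ξ, hξ⟩, rfl⟩
  have h0 := hH.pos ξ hξ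
  simp only
  rw [div_le_div_iff₀ h0 hm]
  calc ⟪x, ξ⟫ * m ≤ ‖x‖ * ‖ξ‖ * m := by gcongr; exact real_inner_le_norm x ξ
    _ = ‖x‖ * (m * ‖ξ‖) := by ring
    _ ≤ ‖x‖ * H ξ := by gcongr; exact hmH ξ

lemma inner_le_dual (hH : IsIpNorm p H) (x ξ : Euc N) : ⟪x, ξ⟫ ≤ dualNorm H x * H ξ := by
  rcases eq_or_ne ξ 0 with rfl | hξ
  · simp [hH.map_zero]
  have := le_ciSup (hH.dual_bddAbove x) ⟨ξ, hξ⟩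
  rwa [div_le_iff₀ (hH.pos ξ hξ)] at this

lemma dual_nonneg (hH : IsIpNorm p H) (x : Euc N) : 0 ≤ dualNorm H x := by
  rcases eq_or_ne x 0 with rfl | hx
  · simp [dualNorm]
  have h1 := hH.inner_le_dual x x
  have h2 : 0 < ⟪x, x⟫ := real_inner_self_pos.2 hx
  exact (pos_of_mul_pos_left (h2.trans_le h1) (hH.nonneg x)).le

lemma dual_le (hH : IsIpNorm p H) {x : Euc N} {r : ℝ} (hr : 0 ≤ r)
    (h : ∀ ξ, ⟪x, ξ⟫ ≤ r * H ξ) : dualNorm H x ≤ r := by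
  refine Real.iSup_le (fun ξ => ?_) hr
  rw [div_le_iff₀ (hH.pos ξ ξ.2)]
  exact h ξ

lemma dual_zero (H : Euc N → ℝ) : dualNorm H 0 = 0 := by simp [dualNorm]

lemma dual_add_le (hH : IsIpNorm p H) (x y : Euc N) :
    dualNorm H (x + y) ≤ dualNorm H x + dualNorm H y := by
  refine hH.dual_le (add_nonneg (hH.dual_nonneg x) (hH.dual_nonneg y)) fun ξ => ?_
  rw [inner_add_left, add_mul]
  exact add_le_add (hH.inner_le_dual x ξ) (hH.inner_le_dual y ξ)

lemma dual_smul_le (hH : IsIpNorm p H) {t : ℝ} (ht : 0 ≤ t) (x : Euc N) :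
    dualNorm H (t • x) ≤ t * dualNorm H x := by
  refine hH.dual_le (mul_nonneg ht (hH.dual_nonneg x)) fun ξ => ?_
  rw [real_inner_smul_left, mul_assoc]
  exact mul_le_mul_of_nonneg_left (hH.inner_le_dual x ξ) ht

lemma dual_neg_le (hH : IsIpNorm p H) (x : Euc N) : dualNorm H (-x) ≤ dualNorm H x := by
  refine hH.dual_le (hH.dual_nonneg x) fun ξ => ?_
  have := hH.inner_le_dual x (-ξ)
  rwa [hH.map_neg, inner_neg_right, ← inner_neg_left] at this

lemma dual_neg (hH : IsIpNorm p H) (x : Euc N) : dualNorm H (-x) = dualNorm H x :=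
  le_antisymm (hH.dual_neg_le x) (by simpa using hH.dual_neg_le (-x))

lemma exists_dual_upper (hH : IsIpNorm p H) : ∃ C > 0, ∀ x, dualNorm H x ≤ C * ‖x‖ := by
  obtain ⟨m, hm, hmH⟩ := hH.exists_lower
  refine ⟨m⁻¹, inv_pos.2 hm, fun x => hH.dual_le (by positivity) fun ξ => ?_⟩
  calc ⟪x, ξ⟫ ≤ ‖x‖ * ‖ξ‖ := real_inner_le_norm x ξ
    _ = m⁻¹ * ‖x‖ * (m * ‖ξ‖) := by field_simp
    _ ≤ _ := by gcongr; exact hmH ξ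

lemma exists_dual_lower (hH : IsIpNorm p H) : ∃ C > 0, ∀ x, ‖x‖ ≤ C * dualNorm H x := by
  obtain ⟨C, hC, hCH⟩ := hH.exists_upper
  refine ⟨C, hC, fun x => ?_⟩
  rcases eq_or_ne x 0 with rfl | hx
  · simp [dual_zero]
  have hx' : 0 < ‖x‖ := norm_pos_iff.2 hx
  have h1 := hH.inner_le_dual x x
  rw [real_inner_self_eq_norm_sq] at h1
  have h2 : ‖x‖ ^ 2 ≤ dualNorm H x * (C * ‖x‖) :=
    h1.trans (mul_le_mul_of_nonneg_left (hCH x) (hH.dual_nonneg x))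
  have : ‖x‖ * ‖x‖ ≤ (C * dualNorm H x) * ‖x‖ := by nlinarith
  exact le_of_mul_le_mul_right this hx'

lemma dual_continuous (hH : IsIpNorm p H) : Continuous (dualNorm H) := by
  obtain ⟨C, hC, hCH⟩ := hH.exists_dual_upper
  refine (LipschitzWith.of_le_add_mul C.toNNReal fun x y => ?_).continuous
  have h1 := hH.dual_add_le (x - y) y
  rw [sub_add_cancel] at h1
  have h2 := hCH (x - y)
  rw [dist_eq_norm, Real.coe_toNNReal _ hC.le]
  linarith

lemma dual_pos (hH : IsIpNorm p H) {x : Euc N} (hx : x ≠ 0) : 0 < dualNorm H x := by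
  obtain ⟨C, hC, hCH⟩ := hH.exists_dual_lower
  exact pos_of_mul_pos_right ((norm_pos_iff.2 hx).trans_le (hCH x)) hC.le

/-! ### The gradient of the norm -/

lemma contDiffAt (hH : IsIpNorm p H) {ξ : Euc N} (hξ : ξ ≠ 0) : ContDiffAt ℝ 2 H ξ :=
  hH.smooth.contDiffAt (isOpen_compl_singleton.mem_nhds hξ)

end IsIpNorm

lemma contDiffAt_gradient {f : Euc N → ℝ} {x : Euc N} (hf : ContDiffAt ℝ 2 f x) :
    ContDiffAt ℝ 1 (gradient f) x := by
  have h : ContDiffAt ℝ 1 (fderiv ℝ f) x := hf.fderiv_right (by norm_num)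
  exact (InnerProductSpace.toDual ℝ (Euc N)).symm.contDiff.contDiffAt.comp x h

lemma inner_fderiv_gradient_comm {f : Euc N → ℝ} {x : Euc N} (hf : ContDiffAt ℝ 2 f x)
    (v w : Euc N) :
    ⟪fderiv ℝ (gradient f) x v, w⟫ = ⟪fderiv ℝ (gradient f) x w, v⟫ := by
  have hd : DifferentiableAt ℝ (gradient f) x :=
    (contDiffAt_gradient hf).differentiableAt (by norm_num)
  have hd' : DifferentiableAt ℝ (fderiv ℝ f) x :=
    (hf.fderiv_right (m := 1) (by norm_num)).differentiableAt (by norm_num)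
  have key : ∀ v w, ⟪fderiv ℝ (gradient f) x v, w⟫ = fderiv ℝ (fderiv ℝ f) x v w := by
    intro v w
    have h1 : HasFDerivAt (fun y => ⟪gradient f y, w⟫)
        ((innerSL ℝ w).comp (fderiv ℝ (gradient f) x)) x := by
      have := (innerSL ℝ w).hasFDerivAt.comp x hd.hasFDerivAt
      refine this.congr_of_eventuallyEq (Eventually.of_forall fun y => ?_)
      simp
    have h2 : HasFDerivAt (fun y => ⟪gradient f y, w⟫)
        ((ContinuousLinearMap.apply ℝ ℝ w).comp (fderiv ℝ (fderiv ℝ f) x)) x := by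
      have := (ContinuousLinearMap.apply ℝ ℝ w).hasFDerivAt.comp x hd'.hasFDerivAt
      refine this.congr_of_eventuallyEq (Eventually.of_forall fun y => ?_)
      simp [inner_gradient_left]
    have h3 := congrArg (fun L : Euc N →L[ℝ] ℝ => L v) (h1.unique h2)
    simpa [real_inner_comm] using h3
  rw [key, key]
  exact (hf.isSymmSndFDerivAt (by simp)).eq v w

namespace IsIpNorm

lemma hasGradientAt (hH : IsIpNorm p H) {ξ : Euc N} (hξ : ξ ≠ 0) :
    HasGradientAt H (gradient H ξ) ξ :=
  ((hH.contDiffAt hξ).differentiableAt (by norm_num)).hasGradientAt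

lemma gradient_contDiffAt (hH : IsIpNorm p H) {ξ : Euc N} (hξ : ξ ≠ 0) :
    ContDiffAt ℝ 1 (gradient H) ξ := contDiffAt_gradient (hH.contDiffAt hξ)

lemma gradient_hasFDerivAt (hH : IsIpNorm p H) {ξ : Euc N} (hξ : ξ ≠ 0) :
    HasFDerivAt (gradient H) (fderiv ℝ (gradient H) ξ) ξ :=
  ((hH.gradient_contDiffAt hξ).differentiableAt (by norm_num)).hasFDerivAt

lemma gradient_smul (hH : IsIpNorm p H) {t : ℝ} (ht : 0 < t) {ξ : Euc N} (hξ : ξ ≠ 0) :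
    gradient H (t • ξ) = gradient H ξ := by
  have h1 : HasGradientAt (fun y => H (t • y)) (t • gradient H (t • ξ)) ξ := by
    rw [hasGradientAt_iff_hasFDerivAt]
    have h := (hH.hasGradientAt (smul_ne_zero ht.ne' hξ)).hasFDerivAt.comp ξ
      ((hasFDerivAt_id ξ).const_smul t)
    refine h.congr_fderiv ?_
    ext v
    simp
  have h2 : HasGradientAt (fun y => H (t • y)) (t • gradient H ξ) ξ := by
    rw [hasGradientAt_iff_hasFDerivAt]
    have h := (hH.hasGradientAt hξ).hasFDerivAt.const_mul t
    refine (h.congr_fderiv ?_).congr_of_eventuallyEq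
      (Eventually.of_forall fun y => hH.map_smul_of_pos ht y)
    ext v
    simp
  exact smul_right_injective _ ht.ne' (h1.unique h2)

lemma gradient_neg (hH : IsIpNorm p H) {ξ : Euc N} (hξ : ξ ≠ 0) :
    gradient H (-ξ) = -gradient H ξ := by
  have h1 : HasGradientAt (fun y => H (-y)) (-gradient H (-ξ)) ξ := by
    rw [hasGradientAt_iff_hasFDerivAt]
    have h := (hH.hasGradientAt (neg_ne_zero.2 hξ)).hasFDerivAt.comp ξ (hasFDerivAt_id ξ).neg
    refine h.congr_fderiv ?_
    ext v
    simp
  have h2 : HasGradientAt (fun y => H (-y)) (gradient H ξ) ξ := by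
    simp only [hH.map_neg]
    exact hH.hasGradientAt hξ
  rw [← h1.unique h2, neg_neg]

lemma hasDerivAt_line (hH : IsIpNorm p H) {ξ : Euc N} (hξ : ξ ≠ 0) (η : Euc N) :
    HasDerivAt (fun t : ℝ => H (ξ + t • η)) ⟪gradient H ξ, η⟫ 0 := by
  have h1 : HasDerivAt (fun t : ℝ => ξ + t • η) η 0 := by
    simpa using ((hasDerivAt_id (0 : ℝ)).smul_const η).const_add ξ
  have h2 : HasFDerivAt H (InnerProductSpace.toDual ℝ _ (gradient H ξ)) (ξ + (0 : ℝ) • η) := by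
    simpa using (hH.hasGradientAt hξ).hasFDerivAt
  exact (h2.comp_hasDerivAt (0 : ℝ) h1).congr_deriv (by simp)

lemma inner_gradient_le (hH : IsIpNorm p H) {ξ : Euc N} (hξ : ξ ≠ 0) (η : Euc N) :
    ⟪gradient H ξ, η⟫ ≤ H η := by
  have hd := hH.hasDerivAt_line hξ η
  have hlim := hd.tendsto_slope_zero_right
  refine le_of_tendsto hlim ?_
  filter_upwards [self_mem_nhdsWithin] with t ht
  have ht : 0 < t := ht
  have h3 := hH.add_le ξ (t • η)
  rw [hH.map_smul_of_pos ht] at h3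
  simp only [zero_add, zero_smul, add_zero, smul_eq_mul]
  rw [inv_mul_le_iff₀ ht]
  linarith

lemma inner_gradient_self (hH : IsIpNorm p H) {ξ : Euc N} (hξ : ξ ≠ 0) :
    ⟪gradient H ξ, ξ⟫ = H ξ := by
  refine le_antisymm (hH.inner_gradient_le hξ ξ) ?_
  have hd := hH.hasDerivAt_line hξ ξ
  have hlim := hd.tendsto_slope_zero_right
  refine ge_of_tendsto hlim ?_
  filter_upwards [self_mem_nhdsWithin] with t ht
  have ht : 0 < t := ht
  have h3 : H (ξ + t • ξ) = (1 + t) * H ξ := by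
    rw [← hH.map_smul_of_pos (by positivity), add_smul, one_smul]
  simp only [zero_add, zero_smul, add_zero, smul_eq_mul, h3]
  rw [le_inv_mul_iff₀ ht]
  linarith

lemma dual_gradient_le (hH : IsIpNorm p H) {ξ : Euc N} (hξ : ξ ≠ 0) :
    dualNorm H (gradient H ξ) ≤ 1 :=
  hH.dual_le zero_le_one fun η => by simpa using hH.inner_gradient_le hξ η

/-- A dual unit vector which norms `a` is the gradient of the norm at `a`. -/
lemma eq_gradient_of_inner_eq (hH : IsIpNorm p H) {a w : Euc N} (ha : a ≠ 0)
    (hw : dualNorm H w ≤ 1) (h : ⟪w, a⟫ = H a) : w = gradient H a := by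
  have hmin : IsLocalMin (fun ξ => H ξ - ⟪w, ξ⟫) a := by
    refine Eventually.of_forall fun ξ => ?_
    have h1 := hH.inner_le_dual w ξ
    have h2 : dualNorm H w * H ξ ≤ 1 * H ξ := mul_le_mul_of_nonneg_right hw (hH.nonneg ξ)
    simp only [h, sub_self]
    linarith
  have hd : HasFDerivAt (fun ξ => H ξ - ⟪w, ξ⟫)
      (InnerProductSpace.toDual ℝ _ (gradient H a) - innerSL ℝ w) a :=
    (hH.hasGradientAt ha).hasFDerivAt.sub (innerSL ℝ w).hasFDerivAt
  have h0 := hmin.hasFDerivAt_eq_zero hd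
  refine (ext_inner_right ℝ fun v => ?_).symm
  have := congrArg (fun L : Euc N →L[ℝ] ℝ => L v) h0
  simpa [sub_eq_zero] using this

lemma dual_gradient (hH : IsIpNorm p H) {ξ : Euc N} (hξ : ξ ≠ 0) :
    dualNorm H (gradient H ξ) = 1 := by
  refine le_antisymm (hH.dual_gradient_le hξ) ?_
  have h := hH.inner_le_dual (gradient H ξ) ξ
  rw [hH.inner_gradient_self hξ] at h
  have := hH.pos ξ hξ
  by_contra! hlt
  nlinarith

/-! ### The Hessian of the norm -/

lemma hess_symm (hH : IsIpNorm p H) {ξ : Euc N} (hξ : ξ ≠ 0) (v w : Euc N) :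
    ⟪fderiv ℝ (gradient H) ξ v, w⟫ = ⟪fderiv ℝ (gradient H) ξ w, v⟫ :=
  inner_fderiv_gradient_comm (hH.contDiffAt hξ) v w

lemma gradient_hasDerivAt_line (hH : IsIpNorm p H) {ξ : Euc N} (hξ : ξ ≠ 0) (v : Euc N) :
    HasDerivAt (fun t : ℝ => gradient H (ξ + t • v)) (fderiv ℝ (gradient H) ξ v) 0 := by
  have h1 : HasDerivAt (fun t : ℝ => ξ + t • v) v 0 := by
    simpa using ((hasDerivAt_id (0 : ℝ)).smul_const v).const_add ξ
  have h2 : HasFDerivAt (gradient H) (fderiv ℝ (gradient H) ξ) (ξ + (0 : ℝ) • v) := by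
    simpa using hH.gradient_hasFDerivAt hξ
  exact h2.comp_hasDerivAt 0 h1

lemma hess_self (hH : IsIpNorm p H) {ξ : Euc N} (hξ : ξ ≠ 0) :
    fderiv ℝ (gradient H) ξ ξ = 0 := by
  have h1 := hH.gradient_hasDerivAt_line hξ ξ
  have h2 : HasDerivAt (fun t : ℝ => gradient H (ξ + t • ξ)) 0 0 := by
    refine (hasDerivAt_const (0 : ℝ) (gradient H ξ)).congr_of_eventuallyEq ?_
    filter_upwards [Ioi_mem_nhds (show (-1 : ℝ) < 0 by norm_num)] with t ht
    have : 0 < 1 + t := by have : -1 < t := ht; linarith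
    rw [← hH.gradient_smul this hξ, add_smul, one_smul]
  exact h1.unique h2

lemma inner_hess_self (hH : IsIpNorm p H) {ξ : Euc N} (hξ : ξ ≠ 0) (v : Euc N) :
    ⟪fderiv ℝ (gradient H) ξ v, ξ⟫ = 0 := by
  rw [hH.hess_symm hξ, hH.hess_self hξ, inner_zero_left]

lemma eventually_line_ne (ξ v : Euc N) (hξ : ξ ≠ 0) : ∀ᶠ t : ℝ in 𝓝 0, ξ + t • v ≠ 0 := by
  have hc : ContinuousAt (fun t : ℝ => ξ + t • v) 0 := by fun_prop
  exact hc.eventually_ne (by simpa using hξ)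

lemma hess_nonneg (hH : IsIpNorm p H) {ξ : Euc N} (hξ : ξ ≠ 0) (v : Euc N) :
    0 ≤ ⟪fderiv ℝ (gradient H) ξ v, v⟫ := by
  have h1 : HasDerivAt (fun t : ℝ => ⟪gradient H (ξ + t • v), v⟫)
      ⟪fderiv ℝ (gradient H) ξ v, v⟫ 0 := by
    simpa using (hH.gradient_hasDerivAt_line hξ v).inner ℝ (hasDerivAt_const (0 : ℝ) v)
  refine ge_of_tendsto h1.tendsto_slope_zero_right ?_
  filter_upwards [self_mem_nhdsWithin,
    nhdsWithin_le_nhds (eventually_line_ne ξ v hξ)] with t ht hne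
  have ht : 0 < t := ht
  have e1 := hH.inner_gradient_self hξ
  have e2 := hH.inner_gradient_self hne
  have i1 := hH.inner_gradient_le hne ξ
  have i2 := hH.inner_gradient_le hξ (ξ + t • v)
  rw [inner_add_right, inner_smul_right] at e2 i2
  simp only [zero_add, zero_smul, add_zero, smul_eq_mul]
  refine mul_nonneg (inv_nonneg.2 ht.le) ?_
  have : 0 ≤ t * (⟪gradient H (ξ + t • v), v⟫ - ⟪gradient H ξ, v⟫) := by nlinarith
  exact nonneg_of_mul_nonneg_right this ht

end IsIpNorm

end

section

/-! ### A sharp determinant estimate -/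

namespace Matrix

variable {ι : Type*} [Fintype ι] [DecidableEq ι]

omit [DecidableEq ι] in
lemma exists_transpose_mul_self_mulVec (S : Matrix ι ι ℝ) (v : ι → ℝ) :
    ∃ ζ, (Sᵀ * S) *ᵥ ζ = Sᵀ *ᵥ v := by
  have hle : LinearMap.range (Sᵀ * S).mulVecLin ≤ LinearMap.range Sᵀ.mulVecLin := by
    rintro _ ⟨ζ, rfl⟩
    exact ⟨S *ᵥ ζ, by simp⟩
  have hr : (Sᵀ * S).rank = Sᵀ.rank := by rw [rank_transpose_mul_self, rank_transpose]
  have := Submodule.eq_of_le_of_finrank_eq hle hr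
  have hv : Sᵀ *ᵥ v ∈ LinearMap.range (Sᵀ * S).mulVecLin := by
    rw [this]; exact ⟨v, rfl⟩
  exact hv

lemma PosSemidef.eq_transpose_mul_self {B : Matrix ι ι ℝ} (hB : B.PosSemidef) :
    ∃ S : Matrix ι ι ℝ, B = Sᵀ * S := by
  open scoped MatrixOrder in
  obtain ⟨S, hS⟩ := CStarAlgebra.nonneg_iff_eq_star_mul_self.mp hB.nonneg
  exact ⟨S, by simpa [star_eq_conjTranspose, conjTranspose_eq_transpose_of_trivial] using hS⟩

lemma posSemidef_one_sub {S F : Matrix ι ι ℝ} (hF : F.IsSymm) {t : ℝ}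
    (h : ∀ ζ, t * (((Sᵀ * S) *ᵥ ζ) ⬝ᵥ (F *ᵥ ((Sᵀ * S) *ᵥ ζ))) ≤ ζ ⬝ᵥ ((Sᵀ * S) *ᵥ ζ)) :
    (1 - t • (S * F * Sᵀ)).PosSemidef := by
  refine PosSemidef.of_dotProduct_mulVec_nonneg ?_ fun v => ?_
  · rw [IsHermitian, conjTranspose_eq_transpose_of_trivial]
    simp [transpose_mul, hF.eq, Matrix.mul_assoc]
  · obtain ⟨ζ, hζ⟩ := exists_transpose_mul_self_mulVec S v
    set k := v - S *ᵥ ζ with hk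
    have hSk : Sᵀ *ᵥ k = 0 := by
      rw [hk, mulVec_sub, mulVec_mulVec, hζ, sub_self]
    have e1 : v ⬝ᵥ ((S * F * Sᵀ) *ᵥ v)
        = ((Sᵀ * S) *ᵥ ζ) ⬝ᵥ (F *ᵥ ((Sᵀ * S) *ᵥ ζ)) := by
      rw [hζ, ← mulVec_mulVec, ← mulVec_mulVec, dotProduct_mulVec, ← mulVec_transpose]
    have e2 : v ⬝ᵥ v = ζ ⬝ᵥ ((Sᵀ * S) *ᵥ ζ) + k ⬝ᵥ k := by
      have hv : v = S *ᵥ ζ + k := by simp [hk]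
      have c1 : (S *ᵥ ζ) ⬝ᵥ k = 0 := by
        rw [dotProduct_comm, dotProduct_mulVec, ← mulVec_transpose, hSk, zero_dotProduct]
      have c2 : (S *ᵥ ζ) ⬝ᵥ (S *ᵥ ζ) = ζ ⬝ᵥ ((Sᵀ * S) *ᵥ ζ) := by
        rw [← mulVec_mulVec, dotProduct_mulVec ζ, vecMul_transpose]
      rw [hv, add_dotProduct, dotProduct_add, dotProduct_add, c1, dotProduct_comm k, c1, c2]
      ring
    have e3 : 0 ≤ k ⬝ᵥ k :=
      Finset.sum_nonneg fun i _ => mul_self_nonneg (k i)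
    have := h ζ
    simp only [star_trivial, sub_mulVec, one_mulVec, dotProduct_sub, smul_mulVec,
      dotProduct_smul, smul_eq_mul, e1, e2]
    linarith

/-- The determinant of a positive semidefinite matrix with eigenvalue `1` is controlled by its
trace. -/
lemma PosSemidef.det_le_of_det_sub_one {A : Matrix ι ι ℝ} (hA : A.PosSemidef)
    (h1 : (A - 1).det = 0) {n : ℕ} (hn : 0 < n) (hcard : Fintype.card ι = n + 1) :
    1 ≤ A.trace ∧ |A.det| ≤ ((A.trace - 1) / n) ^ n := by
  have hspec : (1 : ℝ) ∈ spectrum ℝ A := by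
    rw [spectrum.mem_iff, isUnit_iff_isUnit_det]
    have : algebraMap ℝ (Matrix ι ι ℝ) 1 - A = -(A - 1) := by simp
    rw [this, det_neg, h1]
    simp
  rw [hA.1.spectrum_real_eq_range_eigenvalues] at hspec
  obtain ⟨i, hi⟩ := hspec
  have hnn := hA.eigenvalues_nonneg
  have htr : A.trace = 1 + ∑ j ∈ Finset.univ.erase i, hA.1.eigenvalues j := by
    rw [hA.1.trace_eq_sum_eigenvalues, ← Finset.add_sum_erase _ _ (Finset.mem_univ i)]
    simp [hi]
  have hdet : A.det = ∏ j ∈ Finset.univ.erase i, hA.1.eigenvalues j := by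
    rw [hA.1.det_eq_prod_eigenvalues, ← Finset.mul_prod_erase _ _ (Finset.mem_univ i)]
    simp [hi]
  have hs : 0 ≤ ∑ j ∈ Finset.univ.erase i, hA.1.eigenvalues j :=
    Finset.sum_nonneg fun j _ => hnn j
  refine ⟨by linarith, ?_⟩
  have hn' : (0 : ℝ) < n := by exact_mod_cast hn
  have hce : (Finset.univ.erase i).card = n := by
    rw [Finset.card_erase_of_mem (Finset.mem_univ i), Finset.card_univ, hcard]; simp
  have hp : 0 ≤ ∏ j ∈ Finset.univ.erase i, hA.1.eigenvalues j :=
    Finset.prod_nonneg fun j _ => hnn j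
  have amgm := Real.geom_mean_le_arith_mean_weighted (Finset.univ.erase i) (fun _ => (1 : ℝ) / n)
    hA.1.eigenvalues (fun _ _ => by positivity) (by simp [hce, hn'.ne']) (fun j _ => hnn j)
  rw [Real.finsetProd_rpow _ _ (fun j _ => hnn j), ← Finset.mul_sum] at amgm
  rw [hdet, abs_of_nonneg hp, htr, add_sub_cancel_left]
  calc _ = ((∏ j ∈ Finset.univ.erase i, hA.1.eigenvalues j) ^ ((1 : ℝ) / n)) ^ n := by
        rw [← Real.rpow_natCast, ← Real.rpow_mul hp, one_div_mul_cancel hn'.ne', Real.rpow_one]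
    _ ≤ _ := by
        refine pow_le_pow_left₀ (Real.rpow_nonneg hp _) (amgm.trans_eq ?_) n
        ring

omit [DecidableEq ι] in
/-- A positive semidefinite matrix of trace one with a fixed vector is an orthogonal projection. -/
lemma PosSemidef.eq_vecMulVec_of_trace_eq_one {A : Matrix ι ι ℝ} (hA : A.PosSemidef)
    (htr : A.trace = 1) {k : ι → ℝ} (hk : k ⬝ᵥ k = 1) (hAk : A *ᵥ k = k) :
    A = vecMulVec k k := by
  have hAk' : k ᵥ* A = k := by
    have := hA.1.eq
    rw [conjTranspose_eq_transpose_of_trivial] at this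
    rw [← mulVec_transpose, this, hAk]
  have hP : (A - vecMulVec k k).PosSemidef := by
    refine PosSemidef.of_dotProduct_mulVec_nonneg ?_ fun v => ?_
    · refine hA.1.sub ?_
      rw [IsHermitian, conjTranspose_eq_transpose_of_trivial, transpose_vecMulVec]
    · have h0 := hA.dotProduct_mulVec_nonneg (v - (k ⬝ᵥ v) • k)
      have e : v ⬝ᵥ (A *ᵥ k) = k ⬝ᵥ v := by rw [hAk, dotProduct_comm]
      have e' : k ⬝ᵥ (A *ᵥ v) = k ⬝ᵥ v := by rw [dotProduct_mulVec, hAk']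
      simp only [star_trivial, mulVec_sub, mulVec_smul, dotProduct_sub, sub_dotProduct,
        dotProduct_smul, smul_dotProduct, smul_eq_mul, hAk, e', hk] at h0
      have e2 : v ⬝ᵥ k = k ⬝ᵥ v := dotProduct_comm _ _
      simp only [star_trivial, sub_mulVec, dotProduct_sub, vecMulVec_mulVec, dotProduct_smul]
      simp only [e2] at h0 ⊢
      simp only [op_smul_eq_smul, smul_eq_mul]
      linarith
  have h0 : (A - vecMulVec k k).trace = 0 := by
    rw [trace_sub, htr, trace_vecMulVec, hk, sub_self]
  exact sub_eq_zero.1 (hP.trace_eq_zero_iff.1 h0)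

lemma exists_mulVec_transpose_eq_zero {S : Matrix ι ι ℝ} (h : (Sᵀ * S).det = 0) :
    ∃ k : ι → ℝ, k ⬝ᵥ k = 1 ∧ Sᵀ *ᵥ k = 0 := by
  have hS : Sᵀ.det = 0 := by
    rw [det_mul, det_transpose] at h
    rw [det_transpose]
    exact mul_self_eq_zero.1 h
  obtain ⟨k, hk0, hk⟩ := exists_mulVec_eq_zero_iff.2 hS
  have hpos : 0 < k ⬝ᵥ k := by
    refine lt_of_le_of_ne ((Finset.sum_nonneg fun i _ => mul_self_nonneg (k i))) fun h => hk0 ?_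
    exact dotProduct_self_eq_zero.1 h.symm
  refine ⟨(√(k ⬝ᵥ k))⁻¹ • k, ?_, by rw [mulVec_smul, hk, smul_zero]⟩
  rw [smul_dotProduct, dotProduct_smul, smul_eq_mul, smul_eq_mul, ← mul_assoc, ← mul_inv,
    Real.mul_self_sqrt hpos.le, inv_mul_cancel₀ hpos.ne']

lemma abs_det_one_sub_mul_le {B F : Matrix ι ι ℝ} (hB : B.PosSemidef) (hB0 : B.det = 0)
    (hF : F.IsSymm) {t : ℝ} (h : ∀ ζ, t * ((B *ᵥ ζ) ⬝ᵥ (F *ᵥ (B *ᵥ ζ))) ≤ ζ ⬝ᵥ (B *ᵥ ζ))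
    {n : ℕ} (hn : 0 < n) (hcard : Fintype.card ι = n + 1) :
    t * (B * F).trace ≤ n ∧ |(1 - t • (B * F)).det| ≤ (1 - t * (B * F).trace / n) ^ n := by
  obtain ⟨S, rfl⟩ := hB.eq_transpose_mul_self
  have hA := posSemidef_one_sub hF h
  have hdet : (1 - t • (S * F * Sᵀ)).det = (1 - t • (Sᵀ * S * F)).det := by
    rw [Matrix.mul_assoc Sᵀ, ← Matrix.mul_smul, det_one_sub_mul_comm, smul_mul]
  have htr : (1 - t • (S * F * Sᵀ)).trace = n + 1 - t * (Sᵀ * S * F).trace := by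
    rw [trace_sub, trace_one, hcard, trace_smul, trace_mul_comm (S * F), Matrix.mul_assoc]
    push_cast; simp
  have h1 : ((1 - t • (S * F * Sᵀ)) - 1).det = 0 := by
    obtain ⟨k, hk1, hk⟩ := exists_mulVec_transpose_eq_zero hB0
    refine exists_mulVec_eq_zero_iff.1 ⟨k, ?_, ?_⟩
    · rintro rfl; simp at hk1
    · simp only [sub_mulVec, one_mulVec, smul_mulVec, ← mulVec_mulVec, hk]
      simp
  obtain ⟨h2, h3⟩ := hA.det_le_of_det_sub_one h1 hn hcard
  rw [htr] at h2
  refine ⟨by linarith, ?_⟩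
  rw [hdet, htr] at h3
  convert h3 using 2
  have : (n : ℝ) ≠ 0 := by exact_mod_cast hn.ne'
  field_simp
  ring

lemma smul_mul_mul_eq_of_trace_eq {B F : Matrix ι ι ℝ} (hB : B.PosSemidef) (hB0 : B.det = 0)
    (hF : F.IsSymm) {t : ℝ} (h : ∀ ζ, t * ((B *ᵥ ζ) ⬝ᵥ (F *ᵥ (B *ᵥ ζ))) ≤ ζ ⬝ᵥ (B *ᵥ ζ))
    (htr : t * (B * F).trace = Fintype.card ι - 1) : t • (B * F * B) = B := by
  obtain ⟨S, rfl⟩ := hB.eq_transpose_mul_self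
  have hA := posSemidef_one_sub hF h
  have htr' : (1 - t • (S * F * Sᵀ)).trace = 1 := by
    rw [trace_sub, trace_one, trace_smul, trace_mul_comm (S * F), ← Matrix.mul_assoc,
      smul_eq_mul, htr]
    ring
  obtain ⟨k, hk1, hk⟩ := exists_mulVec_transpose_eq_zero hB0
  have hA' := hA.eq_vecMulVec_of_trace_eq_one htr' hk1 (by
    simp only [sub_mulVec, one_mulVec, smul_mulVec, ← mulVec_mulVec, hk]
    simp)
  have hz : (1 - t • (S * F * Sᵀ)) * S = 0 := by
    rw [hA', vecMulVec_mul, ← mulVec_transpose, hk]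
    simp
  have h2 : S = t • (S * F * Sᵀ * S) := by
    rwa [Matrix.sub_mul, Matrix.one_mul, sub_eq_zero, smul_mul] at hz
  calc t • (Sᵀ * S * F * (Sᵀ * S)) = Sᵀ * (t • (S * F * Sᵀ * S)) := by
        simp only [Matrix.mul_smul, Matrix.mul_assoc]
    _ = Sᵀ * S := by rw [← h2]

end Matrix

end

section

variable {N : ℕ}

/-- The matrix of an endomorphism of Euclidean space in the standard basis. -/
def stdMatrix (L : Euc N →L[ℝ] Euc N) : Matrix (Fin N) (Fin N) ℝ :=
  LinearMap.toMatrix (EuclideanSpace.basisFun (Fin N) ℝ).toBasis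
    (EuclideanSpace.basisFun (Fin N) ℝ).toBasis (L : Euc N →ₗ[ℝ] Euc N)

lemma stdMatrix_mulVec (L : Euc N →L[ℝ] Euc N) (ζ : Euc N) :
    (stdMatrix L).mulVec ζ = L ζ := by
  have := LinearMap.toMatrix_mulVec_repr (EuclideanSpace.basisFun (Fin N) ℝ).toBasis
    (EuclideanSpace.basisFun (Fin N) ℝ).toBasis (L : Euc N →ₗ[ℝ] Euc N) ζ
  have h1 : ⇑((EuclideanSpace.basisFun (Fin N) ℝ).toBasis.repr ζ) = ζ := by
    funext i
    simp
  have h2 : ⇑((EuclideanSpace.basisFun (Fin N) ℝ).toBasis.repr (L ζ)) = L ζ := by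
    funext i
    simp
  rw [h1] at this
  exact this.trans h2

lemma stdMatrix_comp (L K : Euc N →L[ℝ] Euc N) :
    stdMatrix (L ∘L K) = stdMatrix L * stdMatrix K := by
  simp only [stdMatrix]
  exact LinearMap.toMatrix_comp _ (EuclideanSpace.basisFun (Fin N) ℝ).toBasis _ _ _

lemma stdMatrix_one_sub_smul (t : ℝ) (L : Euc N →L[ℝ] Euc N) :
    stdMatrix (1 - t • L) = 1 - t • stdMatrix L := by
  simp [stdMatrix, ContinuousLinearMap.toLinearMap_sub]

lemma trace_stdMatrix (L : Euc N →L[ℝ] Euc N) :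
    (stdMatrix L).trace = LinearMap.trace ℝ (Euc N) (L : Euc N →ₗ[ℝ] Euc N) :=
  (LinearMap.trace_eq_matrix_trace ℝ _ _).symm

lemma det_stdMatrix (L : Euc N →L[ℝ] Euc N) : (stdMatrix L).det = L.det :=
  LinearMap.det_toMatrix _ _

lemma dotProduct_eq_inner (v w : Euc N) : (v : Fin N → ℝ) ⬝ᵥ w = ⟪v, w⟫ := by
  simp [PiLp.inner_apply, dotProduct, mul_comm]

lemma stdMatrix_isSymm {L : Euc N →L[ℝ] Euc N} (hL : ∀ v w, ⟪L v, w⟫ = ⟪L w, v⟫) :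
    (stdMatrix L).IsSymm := by
  refine Matrix.IsSymm.ext fun i j => ?_
  have h := hL (EuclideanSpace.single i 1) (EuclideanSpace.single j 1)
  simpa [stdMatrix, LinearMap.toMatrix_apply, EuclideanSpace.inner_single_right] using h

lemma stdMatrix_posSemidef {L : Euc N →L[ℝ] Euc N} (hL : ∀ v w, ⟪L v, w⟫ = ⟪L w, v⟫)
    (hL0 : ∀ v, 0 ≤ ⟪L v, v⟫) : (stdMatrix L).PosSemidef := by
  refine Matrix.PosSemidef.of_dotProduct_mulVec_nonneg ?_ fun ζ => ?_
  · rw [Matrix.IsHermitian, Matrix.conjTranspose_eq_transpose_of_trivial]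
    exact stdMatrix_isSymm hL
  · have h := hL0 (WithLp.toLp 2 ζ)
    rw [← dotProduct_eq_inner, ← stdMatrix_mulVec, dotProduct_comm] at h
    simpa using h

lemma det_stdMatrix_eq_zero {L : Euc N →L[ℝ] Euc N} {a : Euc N} (ha : a ≠ 0) (h : L a = 0) :
    (stdMatrix L).det = 0 := by
  refine Matrix.exists_mulVec_eq_zero_iff.1 ⟨a, fun h0 => ha ?_, ?_⟩
  · ext i; exact congrFun h0 i
  · rw [stdMatrix_mulVec, h]; rfl

section Comparison

variable {B F : Euc N →L[ℝ] Euc N} {a : Euc N} {t : ℝ}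

lemma stdMatrix_comparison (h : ∀ ζ, t * ⟪F (B ζ), B ζ⟫ ≤ ⟪B ζ, ζ⟫) (ζ : Fin N → ℝ) :
    t * ((stdMatrix B).mulVec ζ ⬝ᵥ (stdMatrix F).mulVec ((stdMatrix B).mulVec ζ))
      ≤ ζ ⬝ᵥ (stdMatrix B).mulVec ζ := by
  have h1 := h (WithLp.toLp 2 ζ)
  rw [← dotProduct_eq_inner, ← dotProduct_eq_inner, ← stdMatrix_mulVec, ← stdMatrix_mulVec] at h1
  rw [dotProduct_comm, dotProduct_comm ζ]
  exact h1

lemma trace_le_and_abs_det_le (hN : 2 ≤ N) (hBs : ∀ v w, ⟪B v, w⟫ = ⟪B w, v⟫)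
    (hB0 : ∀ v, 0 ≤ ⟪B v, v⟫) (ha : a ≠ 0) (hBa : B a = 0) (hFs : ∀ v w, ⟪F v, w⟫ = ⟪F w, v⟫)
    (h : ∀ ζ, t * ⟪F (B ζ), B ζ⟫ ≤ ⟪B ζ, ζ⟫) :
    t * LinearMap.trace ℝ (Euc N) (B ∘L F : Euc N →L[ℝ] Euc N) ≤ ((N - 1 : ℕ) : ℝ) ∧
    |(1 - t • (B ∘L F)).det| ≤
      (1 - t * LinearMap.trace ℝ (Euc N) (B ∘L F : Euc N →L[ℝ] Euc N) / (N - 1 : ℕ)) ^ (N - 1) := by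
  rw [← det_stdMatrix, ← trace_stdMatrix, stdMatrix_one_sub_smul, stdMatrix_comp]
  exact Matrix.abs_det_one_sub_mul_le (stdMatrix_posSemidef hBs hB0)
    (det_stdMatrix_eq_zero ha hBa) (stdMatrix_isSymm hFs) (stdMatrix_comparison h)
    (by omega) (by simp; omega)

lemma smul_comp_eq_of_trace_eq (hBs : ∀ v w, ⟪B v, w⟫ = ⟪B w, v⟫)
    (hB0 : ∀ v, 0 ≤ ⟪B v, v⟫) (ha : a ≠ 0) (hBa : B a = 0) (hFs : ∀ v w, ⟪F v, w⟫ = ⟪F w, v⟫)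
    (h : ∀ ζ, t * ⟪F (B ζ), B ζ⟫ ≤ ⟪B ζ, ζ⟫)
    (htr : t * LinearMap.trace ℝ (Euc N) (B ∘L F : Euc N →L[ℝ] Euc N) = N - 1) (ζ : Euc N) :
    t • B (F (B ζ)) = B ζ := by
  rw [← trace_stdMatrix, stdMatrix_comp] at htr
  have := Matrix.smul_mul_mul_eq_of_trace_eq (stdMatrix_posSemidef hBs hB0)
    (det_stdMatrix_eq_zero ha hBa) (stdMatrix_isSymm hFs) (stdMatrix_comparison h)
    (by rw [htr]; simp)
  have h2 := congrArg (fun A => A.mulVec ζ) this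
  simp only [Matrix.smul_mulVec, ← Matrix.mulVec_mulVec, stdMatrix_mulVec] at h2
  ext i
  exact congrFun h2 i

end Comparison

end

section

variable {N : ℕ} {p : ℝ} {H : Euc N → ℝ}

lemma inner_eq_sum (v w : Euc N) : ⟪v, w⟫ = ∑ i, v i * w i := by
  simp [PiLp.inner_apply, mul_comm]

lemma clm_apply_eq_sum {E : Type*} [NormedAddCommGroup E] [NormedSpace ℝ E]
    (L : Euc N →L[ℝ] E) (ζ : Euc N) :
    L ζ = ∑ i, ζ i • L (EuclideanSpace.single i 1) := by
  conv_lhs => rw [← (EuclideanSpace.basisFun (Fin N) ℝ).sum_repr ζ]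
  simp

lemma divVF_eq_trace {X : Euc N → Euc N} {x : Euc N} {L : Euc N →L[ℝ] Euc N}
    (hX : HasFDerivAt X L x) : divVF X x = LinearMap.trace ℝ (Euc N) L := by
  rw [← trace_stdMatrix, Matrix.trace, divVF]
  refine Finset.sum_congr rfl fun i _ => ?_
  have h : HasFDerivAt (fun y => X y i) ((EuclideanSpace.proj i : Euc N →L[ℝ] ℝ).comp L) x :=
    (EuclideanSpace.proj i : Euc N →L[ℝ] ℝ).hasFDerivAt.comp x hX
  rw [pd, h.fderiv]
  simp [stdMatrix, LinearMap.toMatrix_apply]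

lemma fderiv_single_eq_gradient {f : Euc N → ℝ} (x : Euc N) (j : Fin N) :
    fderiv ℝ f x (EuclideanSpace.single j 1) = gradient f x j := by
  have h : fderiv ℝ f x (EuclideanSpace.single j 1) =
      ⟪gradient f x, EuclideanSpace.single j (1 : ℝ)⟫ := by
    simp [gradient]
  rw [h, EuclideanSpace.inner_single_right]
  simp

namespace IsIpNorm

lemma pd_Vfun (hH : IsIpNorm p H) (hp : 1 < p) {ξ : Euc N} (hξ : ξ ≠ 0) (j : Fin N) :
    pd j (Vfun H p) ξ = H ξ ^ (p - 1) * gradient H ξ j := by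
  have h1 := ((hH.hasGradientAt hξ).hasFDerivAt.rpow_const (p := p)
    (Or.inl (hH.pos ξ hξ).ne')).mul_const p⁻¹
  have h2 : HasFDerivAt (Vfun H p) _ ξ := h1
  rw [pd, h2.fderiv]
  have : p ≠ 0 := by positivity
  simp [fderiv_single_eq_gradient]
  field_simp

lemma hessM_Vfun (hH : IsIpNorm p H) (hp : 1 < p) {ξ : Euc N} (hξ : ξ ≠ 0) (i j : Fin N) :
    hessM (Vfun H p) ξ i j = (p - 1) * H ξ ^ (p - 2) * gradient H ξ i * gradient H ξ j +
      H ξ ^ (p - 1) * fderiv ℝ (gradient H) ξ (EuclideanSpace.single i 1) j := by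
  have he : pd j (Vfun H p) =ᶠ[𝓝 ξ] fun y => H y ^ (p - 1) * gradient H y j := by
    filter_upwards [isOpen_compl_singleton.mem_nhds hξ] with y hy
    exact hH.pd_Vfun hp hy j
  have h1 := (hH.hasGradientAt hξ).hasFDerivAt.rpow_const (p := p - 1)
    (Or.inl (hH.pos ξ hξ).ne')
  have h2 : HasFDerivAt (fun y => gradient H y j) _ ξ :=
    (EuclideanSpace.proj j : Euc N →L[ℝ] ℝ).hasFDerivAt.comp ξ (hH.gradient_hasFDerivAt hξ)
  rw [hessM, Matrix.of_apply, pd, he.fderiv_eq,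
    (show HasFDerivAt (fun y => H y ^ (p - 1) * gradient H y j) _ ξ from h1.mul h2).fderiv]
  have : p - 1 - 1 = p - 2 := by ring
  simp [fderiv_single_eq_gradient, this]
  ring

lemma qForm_hessM_Vfun (hH : IsIpNorm p H) (hp : 1 < p) {ξ : Euc N} (hξ : ξ ≠ 0) (ζ : Euc N) :
    qForm (hessM (Vfun H p) ξ) ζ = (p - 1) * H ξ ^ (p - 2) * ⟪gradient H ξ, ζ⟫ ^ 2 +
      H ξ ^ (p - 1) * ⟪fderiv ℝ (gradient H) ξ ζ, ζ⟫ := by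
  have h1 : ⟪gradient H ξ, ζ⟫ ^ 2 =
      ∑ i, ∑ j, (gradient H ξ i * gradient H ξ j) * ζ i * ζ j := by
    rw [sq, inner_eq_sum, Finset.sum_mul_sum]
    exact Finset.sum_congr rfl fun i _ => Finset.sum_congr rfl fun j _ => by ring
  have h2 : ⟪fderiv ℝ (gradient H) ξ ζ, ζ⟫ =
      ∑ i, ∑ j, fderiv ℝ (gradient H) ξ (EuclideanSpace.single i 1) j * ζ i * ζ j := by
    rw [clm_apply_eq_sum, sum_inner]
    refine Finset.sum_congr rfl fun i _ => ?_
    rw [real_inner_smul_left, inner_eq_sum, Finset.mul_sum]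
    exact Finset.sum_congr rfl fun j _ => by ring
  rw [h1, h2, qForm, Finset.mul_sum, Finset.mul_sum, ← Finset.sum_add_distrib]
  refine Finset.sum_congr rfl fun i _ => ?_
  rw [Finset.mul_sum, Finset.mul_sum, ← Finset.sum_add_distrib]
  refine Finset.sum_congr rfl fun j _ => ?_
  rw [hH.hessM_Vfun hp hξ]
  ring

lemma eq_smul_of_hess_eq_zero_of_norm (hH : IsIpNorm p H) (hp : 1 < p) {ξ ζ : Euc N}
    (hξ : ‖ξ‖ = 1) (h : fderiv ℝ (gradient H) ξ ζ = 0) : ∃ s : ℝ, ζ = s • ξ := by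
  have hξ0 : ξ ≠ 0 := by rintro rfl; simp at hξ
  obtain ⟨c, hc, hcV⟩ := hH.hessV_pos
  refine ⟨⟪gradient H ξ, ζ⟫ / H ξ, ?_⟩
  set s := ⟪gradient H ξ, ζ⟫ / H ξ with hs
  have h1 := hcV ξ hξ (ζ - s • ξ)
  have h2 : ⟪gradient H ξ, ζ - s • ξ⟫ = 0 := by
    rw [inner_sub_right, real_inner_smul_right, hH.inner_gradient_self hξ0, hs,
      div_mul_cancel₀ _ (hH.pos ξ hξ0).ne', sub_self]
  have h3 : fderiv ℝ (gradient H) ξ (ζ - s • ξ) = 0 := by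
    rw [map_sub, map_smul, h, hH.hess_self hξ0, smul_zero, sub_self]
  rw [hH.qForm_hessM_Vfun hp hξ0, h2, h3, inner_zero_left] at h1
  have h4 : ‖ζ - s • ξ‖ ^ 2 ≤ 0 := by
    by_contra! h4
    have := mul_pos hc h4
    norm_num at h1
    linarith
  have h5 : ‖ζ - s • ξ‖ = 0 := by nlinarith [norm_nonneg (ζ - s • ξ)]
  exact sub_eq_zero.1 (norm_eq_zero.1 h5)

lemma smul_hess_smul (hH : IsIpNorm p H) {ξ : Euc N} (hξ : ξ ≠ 0) {t : ℝ} (ht : 0 < t)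
    (ζ : Euc N) :
    t • fderiv ℝ (gradient H) (t • ξ) ζ = fderiv ℝ (gradient H) ξ ζ := by
  have h1 : HasFDerivAt (fun y => gradient H (t • y)) _ ξ :=
    (hH.gradient_hasFDerivAt (smul_ne_zero ht.ne' hξ)).comp ξ ((hasFDerivAt_id ξ).const_smul t)
  have h2 : (fun y => gradient H (t • y)) =ᶠ[𝓝 ξ] gradient H := by
    filter_upwards [isOpen_compl_singleton.mem_nhds hξ] with y hy
    exact hH.gradient_smul ht hy
  have h3 := (h2.hasFDerivAt_iff.1 h1).fderiv
  rw [h3]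
  simp

lemma eq_smul_of_hess_eq_zero (hH : IsIpNorm p H) (hp : 1 < p) {ξ ζ : Euc N}
    (hξ : ξ ≠ 0) (h : fderiv ℝ (gradient H) ξ ζ = 0) : ∃ s : ℝ, ζ = s • ξ := by
  have ht : 0 < ‖ξ‖⁻¹ := inv_pos.2 (norm_pos_iff.2 hξ)
  have h1 := hH.smul_hess_smul hξ ht ζ
  rw [h, smul_eq_zero] at h1
  obtain ⟨s, hs⟩ := hH.eq_smul_of_hess_eq_zero_of_norm hp (norm_smul_inv_norm (𝕜 := ℝ) hξ)
    (h1.resolve_left ht.ne')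
  exact ⟨s * ‖ξ‖⁻¹, by rw [hs, smul_smul]; simp⟩

/-- The range of the Hessian of the norm at `ξ` is the orthogonal complement of `ξ`. -/
lemma exists_hess_eq (hH : IsIpNorm p H) (hp : 1 < p) {ξ v : Euc N}
    (hξ : ξ ≠ 0) (hv : ⟪ξ, v⟫ = 0) : ∃ ζ, fderiv ℝ (gradient H) ξ ζ = v := by
  set B : Euc N →ₗ[ℝ] Euc N := (fderiv ℝ (gradient H) ξ : Euc N →ₗ[ℝ] Euc N) with hB
  have hsymm : B.IsSymmetric := fun v w => by
    rw [real_inner_comm (B w)]; exact hH.hess_symm hξ v w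
  suffices v ∈ LinearMap.range B from this
  have h1 : (LinearMap.range B)ᗮ = LinearMap.ker B := hsymm.orthogonal_range
  rw [← Submodule.orthogonal_orthogonal (LinearMap.range B), h1, Submodule.mem_orthogonal]
  intro ζ hζ
  obtain ⟨s, rfl⟩ := hH.eq_smul_of_hess_eq_zero hp hξ (LinearMap.mem_ker.1 hζ)
  rw [real_inner_smul_left, hv, mul_zero]

end IsIpNorm

end

section

variable {N : ℕ} {p : ℝ} {H f : Euc N → ℝ}

lemma gradient_inner_eq (x v : Euc N) : ⟪gradient f x, v⟫ = fderiv ℝ f x v := by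
  simp [gradient]

lemma inner_gradient_nonpos_of_segment {x z : Euc N} (hf : DifferentiableAt ℝ f x)
    (h : ∀ s ∈ Ioo (0 : ℝ) 1, f (x + s • (z - x)) ≤ f x) : ⟪gradient f x, z - x⟫ ≤ 0 := by
  have h1 : HasDerivAt (fun s : ℝ => x + s • (z - x)) (z - x) 0 := by
    simpa using ((hasDerivAt_id (0 : ℝ)).smul_const (z - x)).const_add x
  have h2 : HasFDerivAt f (fderiv ℝ f x) (x + (0 : ℝ) • (z - x)) := by
    simpa using hf.hasFDerivAt
  have h3 := (h2.comp_hasDerivAt (0 : ℝ) h1).tendsto_slope_zero_right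
  rw [gradient_inner_eq]
  refine le_of_tendsto h3 ?_
  filter_upwards [Ioo_mem_nhdsGT one_pos] with s hs
  have h4 := h s hs
  simp only [Function.comp_apply, zero_add, zero_smul, add_zero, smul_eq_mul]
  exact mul_nonpos_of_nonneg_of_nonpos (inv_nonneg.2 hs.1.le) (by linarith)

namespace IsIpNorm

lemma le_of_dual_le (hH : IsIpNorm p H) (hf : Continuous f) {y : Euc N} {t m : ℝ} (ht : 0 < t)
    (h : ∀ z, dualNorm H (z - y) < t → f z ≤ m) {z : Euc N} (hz : dualNorm H (z - y) ≤ t) :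
    f z ≤ m := by
  have h1 : Tendsto (fun s : ℝ => f (y + s • (z - y))) (𝓝[<] 1) (𝓝 (f z)) := by
    have h2 : Continuous fun s : ℝ => f (y + s • (z - y)) := by fun_prop
    have h3 := (h2.tendsto 1).mono_left (nhdsWithin_le_nhds (s := Iio 1))
    simpa using h3
  refine le_of_tendsto h1 ?_
  filter_upwards [Ioo_mem_nhdsLT one_pos] with s hs
  refine h _ ?_
  rw [add_sub_cancel_left]
  calc dualNorm H (s • (z - y)) ≤ s * dualNorm H (z - y) := hH.dual_smul_le hs.1.le _
    _ ≤ s * t := by gcongr; exact hs.1.le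
    _ < 1 * t := by gcongr; exact hs.2
    _ = t := one_mul t

/-- If an anisotropic ball touches a level set of `f` from inside at `x`, its centre lies on the
anisotropic normal through `x`. -/
lemma sub_eq_smul_of_touching (hH : IsIpNorm p H) (hf : ContDiff ℝ 2 f) {x y : Euc N} {t : ℝ}
    (ht : 0 < t) (hxy : dualNorm H (x - y) = t) (h : ∀ z, dualNorm H (z - y) < t → f z ≤ f x)
    (hx : gradient f x ≠ 0) : x - y = t • gradient H (gradient f x) := by
  set a := gradient f x with ha
  have hz : ∀ s ∈ Ioo (0 : ℝ) 1,
      f (x + s • ((y + t • gradient H a) - x)) ≤ f x := by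
    intro s hs
    refine hH.le_of_dual_le hf.continuous ht h ?_
    have : x + s • ((y + t • gradient H a) - x) - y = (1 - s) • (x - y) +
        (s * t) • gradient H a := by module
    rw [this]
    refine (hH.dual_add_le _ _).trans ?_
    have h1 := hH.dual_smul_le (sub_nonneg.2 hs.2.le) (x - y)
    have h2 := hH.dual_smul_le (mul_nonneg hs.1.le ht.le) (gradient H a)
    rw [hH.dual_gradient hx] at h2
    rw [hxy] at h1
    linarith
  have h1 := inner_gradient_nonpos_of_segment (hf.differentiable (by norm_num) x) hz
  have h2 := hH.inner_le_dual (x - y) a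
  have h3 : ⟪a, (y + t • gradient H a) - x⟫ = t * H a - ⟪x - y, a⟫ := by
    rw [← hH.inner_gradient_self hx, real_inner_comm]
    simp only [inner_sub_left, inner_add_left, real_inner_smul_left]
    ring
  rw [← ha, h3] at h1
  rw [hxy] at h2
  have h4 : t⁻¹ • (x - y) = gradient H a := by
    refine hH.eq_gradient_of_inner_eq hx ?_ ?_
    · refine (hH.dual_smul_le (inv_nonneg.2 ht.le) _).trans ?_
      rw [hxy, inv_mul_cancel₀ ht.ne']
    · rw [real_inner_smul_left, le_antisymm h2 (by linarith), inv_mul_cancel_left₀ ht.ne']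
  rw [← h4, smul_inv_smul₀ ht.ne']

/-- Second-order comparison at a point where an anisotropic ball touches a level set. -/
lemma hess_comparison_of_touching (hH : IsIpNorm p H) (hf : ContDiff ℝ 2 f) {x y : Euc N} {t : ℝ}
    (ht : 0 < t) (hxy : dualNorm H (x - y) = t) (h : ∀ z, dualNorm H (z - y) < t → f z ≤ f x)
    (hx : gradient f x ≠ 0) (ζ : Euc N) :
    t * ⟪fderiv ℝ (gradient f) x (fderiv ℝ (gradient H) (gradient f x) ζ),
        fderiv ℝ (gradient H) (gradient f x) ζ⟫ ≤
      ⟪fderiv ℝ (gradient H) (gradient f x) ζ, ζ⟫ := by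
  have hsub := hH.sub_eq_smul_of_touching hf ht hxy h hx
  set a := gradient f x with ha
  set B := fderiv ℝ (gradient H) with hB
  set F := fderiv ℝ (gradient f) x with hF
  set P : ℝ → Euc N := fun τ => y + t • gradient H (a + τ • ζ) with hP
  have hP0 : P 0 = x := by simp [hP, ← hsub]
  have hPle : ∀ᶠ τ in 𝓝 (0 : ℝ), a + τ • ζ ≠ 0 := eventually_line_ne _ _ hx
  have hPd : ∀ τ, a + τ • ζ ≠ 0 → HasDerivAt P (t • B (a + τ • ζ) ζ) τ := by
    intro τ hτ
    have h1 : HasDerivAt (fun τ : ℝ => a + τ • ζ) ζ τ := by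
      simpa using ((hasDerivAt_id τ).smul_const ζ).const_add a
    exact (((hH.gradient_hasFDerivAt hτ).comp_hasDerivAt τ h1).const_smul t).const_add y
  have hφd : ∀ τ, a + τ • ζ ≠ 0 → HasDerivAt (fun τ => f (P τ))
      ⟪gradient f (P τ) - (a + τ • ζ), t • B (a + τ • ζ) ζ⟫ τ := by
    intro τ hτ
    have h1 := ((hf.differentiable (by norm_num) (P τ)).hasFDerivAt).comp_hasDerivAt τ (hPd τ hτ)
    refine h1.congr_deriv ?_
    rw [inner_sub_left, gradient_inner_eq, real_inner_smul_right, real_inner_comm,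
      hH.inner_hess_self hτ]
    simp
  set u : ℝ → Euc N := fun τ => gradient f (P τ) - (a + τ • ζ) with hu
  have hu0 : u 0 = 0 := by simp [hu, hP0, ha]
  have hud : HasDerivAt u (F (t • B a ζ) - ζ) 0 := by
    have h1 : HasDerivAt (fun τ : ℝ => a + τ • ζ) ζ 0 := by
      simpa using ((hasDerivAt_id (0 : ℝ)).smul_const ζ).const_add a
    have h2 : HasFDerivAt (gradient f) F (P 0) := by
      rw [hP0]
      exact ((contDiffAt_gradient hf.contDiffAt).differentiableAt (by norm_num)).hasFDerivAt
    have h3 := hPd 0 (by simpa using hx)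
    simp only [zero_smul, add_zero] at h3
    exact (h2.comp_hasDerivAt (0 : ℝ) h3).sub h1
  have hw : ContinuousAt (fun τ : ℝ => t • B (a + τ • ζ) ζ) 0 := by
    have h1 : ContinuousAt B (a + (0 : ℝ) • ζ) := by
      simpa using ((hH.gradient_contDiffAt hx).fderiv_right (m := 0) (by norm_num)).continuousAt
    have h2 : ContinuousAt (fun τ : ℝ => a + τ • ζ) 0 := by fun_prop
    have h3 : ContinuousAt (fun τ : ℝ => B (a + τ • ζ)) 0 := ContinuousAt.comp h1 h2
    exact (h3.clm_apply continuousAt_const).const_smul t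
  have hlim : Tendsto (fun τ : ℝ => ⟪τ⁻¹ • u τ, t • B (a + τ • ζ) ζ⟫) (𝓝[>] 0)
      (𝓝 ⟪F (t • B a ζ) - ζ, t • B a ζ⟫) := by
    have h1 := hud.tendsto_slope_zero_right
    simp only [zero_add, hu0, sub_zero] at h1
    have h2 := hw.tendsto.mono_left (nhdsWithin_le_nhds (s := Ioi 0))
    simp only [zero_smul, add_zero] at h2
    exact h1.inner h2
  have key : ⟪F (t • B a ζ) - ζ, t • B a ζ⟫ ≤ 0 := by
    by_contra! hpos
    have hev := (hlim.eventually (lt_mem_nhds hpos))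
    have hev2 : ∀ᶠ τ in 𝓝[>] (0 : ℝ), a + τ • ζ ≠ 0 := hPle.filter_mono nhdsWithin_le_nhds
    obtain ⟨δ, hδ, hδ'⟩ := mem_nhdsGT_iff_exists_Ioo_subset.1 (hev.and hev2)
    have hδ : 0 < δ := hδ
    have hne : ∀ τ ∈ Ico (0 : ℝ) δ, a + τ • ζ ≠ 0 := by
      intro τ hτ
      rcases hτ.1.eq_or_lt with rfl | h0
      · simpa using hx
      · exact (hδ' ⟨h0, hτ.2⟩).2
    have hmono : StrictMonoOn (fun τ => f (P τ)) (Ico 0 δ) := by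
      refine strictMonoOn_of_deriv_pos (convex_Ico 0 δ)
        (fun τ hτ => (hφd τ (hne τ hτ)).continuousAt.continuousWithinAt) fun τ hτ => ?_
      rw [interior_Ico] at hτ
      rw [(hφd τ (hne τ (Ioo_subset_Ico_self hτ))).deriv]
      have h1 : 0 < ⟪τ⁻¹ • u τ, t • B (a + τ • ζ) ζ⟫ := (hδ' hτ).1
      rw [real_inner_smul_left] at h1
      exact pos_of_mul_pos_right h1 (inv_nonneg.2 hτ.1.le)
    have h1 := hmono (left_mem_Ico.2 hδ) (⟨by positivity, by linarith⟩ : δ / 2 ∈ Ico 0 δ)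
      (by positivity)
    have h2 : f (P (δ / 2)) ≤ f x := by
      refine hH.le_of_dual_le hf.continuous ht h ?_
      simp only [hP, add_sub_cancel_left]
      refine (hH.dual_smul_le ht.le _).trans ?_
      rw [hH.dual_gradient (hne _ ⟨by positivity, by linarith⟩), mul_one]
    simp only [hP0] at h1
    linarith
  rw [map_smul, inner_sub_left, real_inner_smul_right, real_inner_smul_right,
    real_inner_smul_left] at key
  have h5 : t * (t * ⟪F (B a ζ), B a ζ⟫ - ⟪ζ, B a ζ⟫) ≤ 0 := by linarith
  rw [real_inner_comm ζ]
  nlinarith [(nonpos_of_mul_nonpos_right h5 ht)]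

end IsIpNorm

end

section

variable {N : ℕ} {p : ℝ} {H f : Euc N → ℝ} {x y : Euc N}

/-- The anisotropic inward normal field `∇H(ν)` associated to a defining function. -/
def anisoNormal (H f : Euc N → ℝ) (x : Euc N) : Euc N := gradient H (inwardField f x)

/-- The anisotropic mean curvature of the level sets of a defining function. -/
def anisoCurv (H f : Euc N → ℝ) (x : Euc N) : ℝ := -divVF (anisoNormal H f) x

lemma continuous_gradient (hf : ContDiff ℝ 2 f) : Continuous (gradient f) :=
  continuous_iff_continuousAt.2 fun _ => (contDiffAt_gradient hf.contDiffAt).continuousAt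

lemma isOpen_gradient_ne_zero (hf : ContDiff ℝ 2 f) : IsOpen {x | gradient f x ≠ 0} :=
  isOpen_ne_fun (continuous_gradient hf) continuous_const

namespace IsIpNorm

lemma anisoNormal_eq (hH : IsIpNorm p H) (hx : gradient f x ≠ 0) :
    anisoNormal H f x = -gradient H (gradient f x) := by
  have h1 : inwardField f x = -(‖gradient f x‖⁻¹ • gradient f x) := by
    rw [inwardField, neg_smul]
  have hpos : 0 < ‖gradient f x‖⁻¹ := inv_pos.2 (norm_pos_iff.2 hx)
  rw [anisoNormal, h1, hH.gradient_neg (smul_ne_zero hpos.ne' hx), hH.gradient_smul hpos hx]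

lemma anisoNormal_eventuallyEq (hH : IsIpNorm p H) (hf : ContDiff ℝ 2 f)
    (hx : gradient f x ≠ 0) :
    anisoNormal H f =ᶠ[𝓝 x] fun y => -gradient H (gradient f y) := by
  filter_upwards [(isOpen_gradient_ne_zero hf).mem_nhds hx] with y hy
  exact hH.anisoNormal_eq hy

lemma anisoNormal_contDiffAt (hH : IsIpNorm p H) (hf : ContDiff ℝ 2 f)
    (hx : gradient f x ≠ 0) : ContDiffAt ℝ 1 (anisoNormal H f) x :=
  ContDiffAt.congr_of_eventuallyEq
    ((hH.gradient_contDiffAt hx).comp x (contDiffAt_gradient hf.contDiffAt)).neg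
    (hH.anisoNormal_eventuallyEq hf hx)

lemma anisoNormal_hasFDerivAt (hH : IsIpNorm p H) (hf : ContDiff ℝ 2 f)
    (hx : gradient f x ≠ 0) :
    HasFDerivAt (anisoNormal H f)
      (-(fderiv ℝ (gradient H) (gradient f x) ∘L fderiv ℝ (gradient f) x)) x := by
  have h1 : HasFDerivAt (gradient f) (fderiv ℝ (gradient f) x) x :=
    ((contDiffAt_gradient hf.contDiffAt).differentiableAt (by norm_num)).hasFDerivAt
  exact (((hH.gradient_hasFDerivAt hx).comp x h1).neg).congr_of_eventuallyEq
    (hH.anisoNormal_eventuallyEq hf hx)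

lemma anisoCurv_eq (hH : IsIpNorm p H) (hf : ContDiff ℝ 2 f) (hx : gradient f x ≠ 0) :
    anisoCurv H f x = LinearMap.trace ℝ (Euc N)
      (fderiv ℝ (gradient H) (gradient f x) ∘L fderiv ℝ (gradient f) x : Euc N →L[ℝ] Euc N) := by
  rw [anisoCurv, divVF_eq_trace (hH.anisoNormal_hasFDerivAt hf hx)]
  simp

lemma anisoCurv_continuousAt (hH : IsIpNorm p H) (hf : ContDiff ℝ 2 f)
    (hx : gradient f x ≠ 0) : ContinuousAt (anisoCurv H f) x := by
  have h1 : ContinuousAt (fderiv ℝ (anisoNormal H f)) x :=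
    ((hH.anisoNormal_contDiffAt hf hx).fderiv_right (m := 0) (by norm_num)).continuousAt
  have h2 : anisoCurv H f =ᶠ[𝓝 x] fun y => -∑ i : Fin N,
      fderiv ℝ (anisoNormal H f) y (EuclideanSpace.single i 1) i := by
    filter_upwards [(isOpen_gradient_ne_zero hf).mem_nhds hx] with y hy
    have h3 := hH.anisoNormal_hasFDerivAt hf hy
    rw [anisoCurv, divVF_eq_trace h3, ← h3.fderiv, ← trace_stdMatrix, Matrix.trace]
    simp [stdMatrix, LinearMap.toMatrix_apply]
  refine ContinuousAt.congr ?_ h2.symm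
  refine (tendsto_finsetSum _ fun i _ => ?_).neg
  exact ((EuclideanSpace.proj i : Euc N →L[ℝ] ℝ).continuous.continuousAt).comp
    (h1.clm_apply continuousAt_const)

lemma inner_gradient_anisoNormal (hH : IsIpNorm p H) (hx : gradient f x ≠ 0) :
    ⟪gradient f x, anisoNormal H f x⟫ = -H (gradient f x) := by
  rw [hH.anisoNormal_eq hx, inner_neg_right, real_inner_comm, hH.inner_gradient_self hx]

lemma dual_anisoNormal (hH : IsIpNorm p H) (hx : gradient f x ≠ 0) :
    dualNorm H (anisoNormal H f x) = 1 := by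
  rw [hH.anisoNormal_eq hx, hH.dual_neg, hH.dual_gradient hx]

lemma inner_gradient_fderiv_anisoNormal (hH : IsIpNorm p H) (hf : ContDiff ℝ 2 f)
    (hx : gradient f x ≠ 0) (v : Euc N) :
    ⟪gradient f x, fderiv ℝ (anisoNormal H f) x v⟫ = 0 := by
  rw [(hH.anisoNormal_hasFDerivAt hf hx).fderiv, real_inner_comm,
    neg_apply, inner_neg_left, ContinuousLinearMap.comp_apply,
    hH.inner_hess_self hx, neg_zero]

end IsIpNorm

/-- The anisotropic ball of radius `t` about `y` touches the level set of `f` through `x`. -/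
structure TouchesAt (H f : Euc N → ℝ) (x y : Euc N) (t : ℝ) : Prop where
  pos : 0 < t
  dual_eq : dualNorm H (x - y) = t
  le : ∀ z, dualNorm H (z - y) < t → f z ≤ f x
  ne_zero : gradient f x ≠ 0

namespace TouchesAt

variable {t : ℝ}

lemma center_eq (hH : IsIpNorm p H) (hf : ContDiff ℝ 2 f) (h : TouchesAt H f x y t) :
    y = x + t • anisoNormal H f x := by
  have h1 := hH.sub_eq_smul_of_touching hf h.pos h.dual_eq h.le h.ne_zero
  rw [hH.anisoNormal_eq h.ne_zero, smul_neg, ← h1]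
  abel

lemma mul_curv_le_and_abs_det_le (hH : IsIpNorm p H) (hN : 2 ≤ N) (hf : ContDiff ℝ 2 f)
    (h : TouchesAt H f x y t) :
    t * anisoCurv H f x ≤ ((N - 1 : ℕ) : ℝ) ∧
    |(1 + t • fderiv ℝ (anisoNormal H f) x).det| ≤
      (1 - t * anisoCurv H f x / (N - 1 : ℕ)) ^ (N - 1) := by
  rw [hH.anisoCurv_eq hf h.ne_zero, (hH.anisoNormal_hasFDerivAt hf h.ne_zero).fderiv, smul_neg,
    ← sub_eq_add_neg]
  exact trace_le_and_abs_det_le hN (hH.hess_symm h.ne_zero) (hH.hess_nonneg h.ne_zero) h.ne_zero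
    (hH.hess_self h.ne_zero) (inner_fderiv_gradient_comm hf.contDiffAt)
    (hH.hess_comparison_of_touching hf h.pos h.dual_eq h.le h.ne_zero)

lemma add_smul_fderiv_eq_zero (hH : IsIpNorm p H) (hp : 1 < p) (hf : ContDiff ℝ 2 f)
    (h : TouchesAt H f x y t) (hc : t * anisoCurv H f x = N - 1) {v : Euc N}
    (hv : ⟪gradient f x, v⟫ = 0) : v + t • fderiv ℝ (anisoNormal H f) x v = 0 := by
  obtain ⟨ζ, rfl⟩ := hH.exists_hess_eq hp h.ne_zero hv
  rw [hH.anisoCurv_eq hf h.ne_zero] at hc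
  rw [(hH.anisoNormal_hasFDerivAt hf h.ne_zero).fderiv]
  have := smul_comp_eq_of_trace_eq (hH.hess_symm h.ne_zero) (hH.hess_nonneg h.ne_zero) h.ne_zero
    (hH.hess_self h.ne_zero) (inner_fderiv_gradient_comm hf.contDiffAt)
    (hH.hess_comparison_of_touching hf h.pos h.dual_eq h.le h.ne_zero) hc ζ
  simp [this]

end TouchesAt

lemma IsIpNorm.exists_nearest (hH : IsIpNorm p H) (hf : Continuous f) {s : ℝ}
    (hs : ∃ z, s ≤ f z) (hy : f y < s) :
    ∃ x, 0 < dualNorm H (x - y) ∧ f x = s ∧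
      ∀ z, dualNorm H (z - y) < dualNorm H (x - y) → f z < s := by
  obtain ⟨z₀, hz₀⟩ := hs
  have hd : Continuous fun z => dualNorm H (z - y) :=
    hH.dual_continuous.comp (continuous_id.sub continuous_const)
  set K : Set (Euc N) := {z | s ≤ f z} ∩ {z | dualNorm H (z - y) ≤ dualNorm H (z₀ - y)} with hK
  have hKc : IsCompact K := by
    refine Metric.isCompact_of_isClosed_isBounded
      ((isClosed_le continuous_const hf).inter (isClosed_le hd continuous_const)) ?_
    obtain ⟨C, hC, hCH⟩ := hH.exists_dual_lower
    refine (Metric.isBounded_closedBall (x := y) (r := C * dualNorm H (z₀ - y))).subset ?_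
    rintro z ⟨-, hz⟩
    rw [Metric.mem_closedBall, dist_eq_norm]
    exact (hCH _).trans (mul_le_mul_of_nonneg_left hz hC.le)
  obtain ⟨x, hxK, hx⟩ := hKc.exists_isMinOn ⟨z₀, hz₀, le_refl (dualNorm H (z₀ - y))⟩ hd.continuousOn
  have hlt : ∀ z, dualNorm H (z - y) < dualNorm H (x - y) → f z < s := by
    intro z hz
    by_contra! hzs
    exact absurd (hx ⟨hzs, hz.le.trans hxK.2⟩) (not_le.2 hz)
  have hxy : x ≠ y := by rintro rfl; exact absurd hxK.1 (not_le.2 hy)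
  have hpos := hH.dual_pos (sub_ne_zero.2 hxy)
  exact ⟨x, hpos, le_antisymm
    (hH.le_of_dual_le hf hpos (fun z hz => (hlt z hz).le) le_rfl) hxK.1, hlt⟩

end

section

variable {N : ℕ} {p : ℝ} {H f : Euc N → ℝ}

/-- Determinant of the block map `(u, σ) ↦ (A u + σ Z, ⟪g, u⟫)` when `A` preserves `⟪g, ·⟫`. -/
lemma abs_det_prod_eq {A : Euc N →L[ℝ] Euc N} {g Z : Euc N} (hA : ∀ u, ⟪g, A u⟫ = ⟪g, u⟫)
    {L : Euc N × ℝ →L[ℝ] Euc N × ℝ} (hL : ∀ u σ, L (u, σ) = (A u + σ • Z, ⟪g, u⟫)) :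
    |L.det| = |⟪g, Z⟫| * |A.det| := by
  set T₁ : Euc N × ℝ →ₗ[ℝ] Euc N × ℝ :=
    LinearMap.transvection (LinearMap.snd ℝ (Euc N) ℝ) (Z, 0) with hT₁
  set T₂ : Euc N × ℝ →ₗ[ℝ] Euc N × ℝ :=
    LinearMap.transvection ((innerₗ (Euc N) g).comp (LinearMap.fst ℝ (Euc N) ℝ)) (0, 1) with hT₂
  set D₁ : Euc N × ℝ →ₗ[ℝ] Euc N × ℝ := LinearMap.prodMap (A : Euc N →ₗ[ℝ] Euc N) LinearMap.id
  set D₂ : Euc N × ℝ →ₗ[ℝ] Euc N × ℝ :=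
    LinearMap.prodMap LinearMap.id ((-⟪g, Z⟫) • (LinearMap.id : ℝ →ₗ[ℝ] ℝ))
  have hcomp : (L : Euc N × ℝ →ₗ[ℝ] Euc N × ℝ) = T₂ ∘ₗ D₂ ∘ₗ T₁ ∘ₗ D₁ := by
    refine LinearMap.ext fun ⟨u, σ⟩ => ?_
    rw [ContinuousLinearMap.coe_coe, hL]
    simp [T₁, T₂, D₁, D₂, LinearMap.transvection.apply, inner_add_right, real_inner_smul_right, hA]
    ring
  rw [ContinuousLinearMap.det, hcomp, LinearMap.det_comp, LinearMap.det_comp, LinearMap.det_comp,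
    hT₁, hT₂, LinearMap.transvection.det, LinearMap.transvection.det, LinearMap.det_prodMap,
    LinearMap.det_prodMap]
  simp [abs_mul]

lemma lintegral_one_sub_div_pow {r T : ℝ} (hr : 0 < r) (hT : 0 ≤ T) (hTr : T ≤ r) (n : ℕ) :
    ∫⁻ t in Ioc 0 T, ENNReal.ofReal ((1 - t / r) ^ n) =
      ENNReal.ofReal (r / (n + 1 : ℕ) * (1 - (1 - T / r) ^ (n + 1))) := by
  have hc : Continuous fun t : ℝ => (1 - t / r) ^ n := by fun_prop
  rw [← ofReal_integral_eq_lintegral_ofReal (hc.integrableOn_Ioc)]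
  · rw [← intervalIntegral.integral_of_le hT]
    congr 1
    have hd : ∀ t ∈ uIcc 0 T, HasDerivAt (fun t => -(r / (n + 1 : ℕ)) * (1 - t / r) ^ (n + 1))
        ((1 - t / r) ^ n) t := by
      intro t _
      have h1 : HasDerivAt (fun t : ℝ => 1 - t / r) (-(1 / r)) t :=
        ((hasDerivAt_id t).div_const r).const_sub 1
      refine ((h1.pow (n + 1)).const_mul _).congr_deriv ?_
      have : ((n + 1 : ℕ) : ℝ) ≠ 0 := by positivity
      field_simp
      simp
    rw [intervalIntegral.integral_eq_sub_of_hasDerivAt hd (hc.intervalIntegrable _ _)]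
    simp
    ring
  · refine (ae_restrict_iff' measurableSet_Ioc).2 (Eventually.of_forall fun t ht => ?_)
    have : t / r ≤ 1 := (div_le_one hr).2 (ht.2.trans hTr)
    exact pow_nonneg (by linarith) _

lemma measurable_comp_prod_of_continuous {V : Type*} [TopologicalSpace V]
    [SecondCountableTopology V] [MeasurableSpace V] [BorelSpace V] {φ : V × ℝ → ℝ}
    (hφ : Continuous φ) {D : Euc N → V} (hD : Measurable D) :
    Measurable fun q : Euc N × ℝ => φ (D q.1, q.2) :=
  hφ.measurable.comp ((hD.comp measurable_fst).prodMk measurable_snd)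

lemma measurable_abs_det_one_add_smul {D : Euc N → Euc N →L[ℝ] Euc N} (hD : Measurable D) :
    Measurable fun q : Euc N × ℝ => |(1 + q.2 • D q.1).det| := by
  have hprop : ProperSpace (Euc N →L[ℝ] Euc N) := FiniteDimensional.proper ℝ _
  have h1 : Continuous fun w : (Euc N →L[ℝ] Euc N) × ℝ => |(1 + w.2 • w.1).det| :=
    (ContinuousLinearMap.continuous_det.comp
      (continuous_const.add (continuous_snd.smul continuous_fst))).abs
  exact measurable_comp_prod_of_continuous h1 hD

/-- The normal map `(x, t) ↦ (x + t Z(x), f x)`. -/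
def normalMap (H f : Euc N → ℝ) (q : Euc N × ℝ) : Euc N × ℝ :=
  (q.1 + q.2 • anisoNormal H f q.1, f q.1)

namespace IsIpNorm

lemma normalMap_hasFDerivAt (hH : IsIpNorm p H) (hf : ContDiff ℝ 2 f) {q : Euc N × ℝ}
    (hq : gradient f q.1 ≠ 0) :
    ∃ L : Euc N × ℝ →L[ℝ] Euc N × ℝ, HasFDerivAt (normalMap H f) L q ∧
      |L.det| = H (gradient f q.1) * |(1 + q.2 • fderiv ℝ (anisoNormal H f) q.1).det| := by
  have hZ : HasFDerivAt (anisoNormal H f) (fderiv ℝ (anisoNormal H f) q.1) q.1 :=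
    (hH.anisoNormal_hasFDerivAt hf hq).differentiableAt.hasFDerivAt
  have hZ' : HasFDerivAt (fun q : Euc N × ℝ => anisoNormal H f q.1) _ q :=
    hZ.comp q hasFDerivAt_fst
  have hf' : HasFDerivAt (fun q : Euc N × ℝ => f q.1) _ q :=
    (hf.differentiable (by norm_num) q.1).hasFDerivAt.comp q hasFDerivAt_fst
  have hs : HasFDerivAt (fun q : Euc N × ℝ => q.2 • anisoNormal H f q.1) _ q :=
    hasFDerivAt_snd.smul hZ'
  have ha : HasFDerivAt (fun q : Euc N × ℝ => q.1 + q.2 • anisoNormal H f q.1) _ q :=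
    hasFDerivAt_fst.add hs
  have h1 : HasFDerivAt (normalMap H f) _ q := ha.prodMk hf'
  refine ⟨_, h1, ?_⟩
  rw [abs_det_prod_eq (g := gradient f q.1) (Z := anisoNormal H f q.1)
    (A := 1 + q.2 • fderiv ℝ (anisoNormal H f) q.1)]
  · rw [hH.inner_gradient_anisoNormal hq, abs_neg, abs_of_nonneg (hH.nonneg _)]
  · intro u
    rw [add_apply, inner_add_right, smul_apply,
      real_inner_smul_right, hH.inner_gradient_fderiv_anisoNormal hf hq, mul_zero, add_zero,
      one_apply_eq_self]
  · intro u σ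
    simp [add_assoc]

/-- Area inequality for the set of centres of anisotropic balls touching level sets of `f`. -/
lemma volume_le_of_touchesAt (hH : IsIpNorm p H) (hN : 2 ≤ N) (hf : ContDiff ℝ 2 f)
    {S : Set (Euc N)} (hS : MeasurableSet S) (hSg : ∀ x ∈ S, gradient f x ≠ 0) {r T : ℝ}
    (hr : 0 < r) (hT : 0 ≤ T) (hTr : T ≤ r) (hcurv : ∀ x ∈ S, (N - 1 : ℕ) / r ≤ anisoCurv H f x)
    {P : Set (Euc N × ℝ)}
    (hP : ∀ y s, (y, s) ∈ P → ∃ x ∈ S, ∃ t ≤ T, TouchesAt H f x y t ∧ f x = s) :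
    volume P ≤ (∫⁻ x in S, ENNReal.ofReal (H (gradient f x))) *
      ENNReal.ofReal (r / N * (1 - (1 - T / r) ^ N)) := by
  set n := N - 1 with hn
  have hNn : N = n + 1 := by omega
  have hn0 : (0 : ℝ) < n := by
    have : 0 < n := by omega
    exact_mod_cast this
  set Z' := fderiv ℝ (anisoNormal H f) with hZ'
  have hmeasd : Measurable fun q : Euc N × ℝ => |(1 + q.2 • Z' q.1).det| :=
    measurable_abs_det_one_add_smul (measurable_fderiv ℝ (anisoNormal H f))
  set R : Set (Euc N × ℝ) := (S ×ˢ Ioc 0 T) ∩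
    {q | |(1 + q.2 • Z' q.1).det| ≤ (1 - q.2 / r) ^ n} with hR
  have hRm : MeasurableSet R :=
    (hS.prod measurableSet_Ioc).inter (measurableSet_le hmeasd (by fun_prop))
  have hPR : P ⊆ normalMap H f '' R := by
    rintro ⟨y, s⟩ hys
    obtain ⟨x, hx, t, htT, htouch, hfx⟩ := hP y s hys
    refine ⟨(x, t), ⟨⟨hx, htouch.pos, htT⟩, ?_⟩, ?_⟩
    · obtain ⟨h1, h2⟩ := htouch.mul_curv_le_and_abs_det_le hH hN hf
      refine h2.trans (pow_le_pow_left₀ ?_ ?_ _)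
      · rw [sub_nonneg, div_le_one hn0]; exact h1
      · refine sub_le_sub_left ?_ 1
        have h3 := mul_le_mul_of_nonneg_left (hcurv x hx) htouch.pos.le
        rw [le_div_iff₀ hn0]
        calc t / r * n = t * (n / r) := by ring
          _ ≤ _ := h3
    · rw [normalMap, ← htouch.center_eq hH hf, hfx]
  have hder : ∀ q : Euc N × ℝ, ∃ L : Euc N × ℝ →L[ℝ] Euc N × ℝ, gradient f q.1 ≠ 0 →
      HasFDerivAt (normalMap H f) L q ∧
      |L.det| = H (gradient f q.1) * |(1 + q.2 • Z' q.1).det| := by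
    intro q
    by_cases hq : gradient f q.1 ≠ 0
    · obtain ⟨L, hL⟩ := hH.normalMap_hasFDerivAt hf hq
      exact ⟨L, fun _ => hL⟩
    · exact ⟨0, fun h => absurd h hq⟩
  choose L hL using hder
  have hHm : Measurable fun x => ENNReal.ofReal (H (gradient f x)) :=
    (ENNReal.continuous_ofReal.comp (hH.continuous.comp (continuous_gradient hf))).measurable
  calc volume P ≤ volume (normalMap H f '' R) := measure_mono hPR
    _ ≤ ∫⁻ q in R, ENNReal.ofReal |(L q).det| :=
        addHaar_image_le_lintegral_abs_det_fderiv
          ((volume : Measure (Euc N)).prod (volume : Measure ℝ)) hRm fun q hq =>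
             ((hL q (hSg _ hq.1.1)).1).hasFDerivWithinAt
    _ ≤ ∫⁻ q in R, ENNReal.ofReal (H (gradient f q.1)) * ENNReal.ofReal ((1 - q.2 / r) ^ n) := by
        refine setLIntegral_mono' hRm fun q hq => ?_
        rw [(hL q (hSg _ hq.1.1)).2, ENNReal.ofReal_mul (hH.nonneg _)]
        exact mul_le_mul_right (ENNReal.ofReal_le_ofReal hq.2) _
    _ ≤ ∫⁻ q in S ×ˢ Ioc 0 T,
          ENNReal.ofReal (H (gradient f q.1)) * ENNReal.ofReal ((1 - q.2 / r) ^ n) :=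
        lintegral_mono_set inter_subset_left
    _ = (∫⁻ x in S, ENNReal.ofReal (H (gradient f x))) *
          ∫⁻ t in Ioc 0 T, ENNReal.ofReal ((1 - t / r) ^ n) := by
        rw [Measure.volume_eq_prod, ← Measure.prod_restrict]
        exact lintegral_prod_mul (f := fun x => ENNReal.ofReal (H (gradient f x)))
          (g := fun t : ℝ => ENNReal.ofReal ((1 - t / r) ^ n)) hHm.aemeasurable
          (by fun_prop)
    _ = _ := by rw [lintegral_one_sub_div_pow hr hT hTr, ← hNn]

end IsIpNorm

end

section

variable {N : ℕ} {p : ℝ} {H f η : Euc N → ℝ}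

lemma trace_smulRight_clm (φ : Euc N →L[ℝ] ℝ) (w : Euc N) :
    LinearMap.trace ℝ (Euc N) (φ.smulRight w : Euc N →L[ℝ] Euc N) = φ w :=
  LinearMap.trace_smulRight (φ : Euc N →ₗ[ℝ] ℝ) w

lemma integrable_pd {X : Euc N → Euc N} (hX : ContDiff ℝ 1 X) (hXc : HasCompactSupport X)
    (i : Fin N) : Integrable (pd i fun y => X y i) := by
  have hc : ContDiff ℝ 1 fun y => X y i :=
    (EuclideanSpace.proj i : Euc N →L[ℝ] ℝ).contDiff.comp hX
  have hs : HasCompactSupport fun y => X y i := hXc.comp_left (g := fun v : Euc N => v i) rfl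
  have h1 : Continuous (fderiv ℝ fun y => X y i) := hc.continuous_fderiv (by norm_num)
  exact (h1.clm_apply continuous_const).integrable_of_hasCompactSupport
    (hs.fderiv_apply (𝕜 := ℝ) _)

lemma integrable_divVF {X : Euc N → Euc N} (hX : ContDiff ℝ 1 X) (hXc : HasCompactSupport X) :
    Integrable (divVF X) :=
  integrable_finsetSum _ fun i _ => integrable_pd hX hXc i

/-- The divergence theorem for compactly supported fields. -/
lemma integral_divVF_eq_zero {X : Euc N → Euc N} (hX : ContDiff ℝ 1 X)
    (hXc : HasCompactSupport X) : ∫ x, divVF X x = 0 := by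
  have hc : ∀ i : Fin N, ContDiff ℝ 1 fun y => X y i := fun i =>
    (EuclideanSpace.proj i : Euc N →L[ℝ] ℝ).contDiff.comp hX
  have hs : ∀ i : Fin N, HasCompactSupport fun y => X y i := fun i =>
    hXc.comp_left (g := fun v : Euc N => v i) rfl
  simp only [divVF]
  rw [integral_finsetSum _ fun i _ => integrable_pd hX hXc i]
  refine Finset.sum_eq_zero fun i _ => ?_
  have h := integral_mul_fderiv_eq_neg_fderiv_mul_of_integrable (μ := (volume : Measure (Euc N)))
    (f := fun _ => (1 : ℝ)) (g := fun y => X y i) (v := EuclideanSpace.single i 1)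
    (by simp)
    ((integrable_pd hX hXc i).congr (Eventually.of_forall fun x => by simp [pd]))
    (by simpa using (hc i).continuous.integrable_of_hasCompactSupport (hs i))
    (by simp) (fun x _ => (hc i).differentiable (by norm_num) x)
  simpa [pd] using h

section Fields

variable {x : Euc N}

/-- The tangential field whose divergence gives the anisotropic Minkowski formula. -/
def minkowskiField (H f : Euc N → ℝ) (x : Euc N) : Euc N :=
  H (gradient f x) • x + ⟪gradient f x, x⟫ • anisoNormal H f x

lemma IsIpNorm.inner_gradient_minkowskiField (hH : IsIpNorm p H) (hx : gradient f x ≠ 0) :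
    ⟪gradient f x, minkowskiField H f x⟫ = 0 := by
  rw [minkowskiField, inner_add_right, real_inner_smul_right, real_inner_smul_right,
    hH.inner_gradient_anisoNormal hx]
  ring

lemma IsIpNorm.minkowskiField_contDiffAt (hH : IsIpNorm p H) (hf : ContDiff ℝ 2 f)
    (hx : gradient f x ≠ 0) : ContDiffAt ℝ 1 (minkowskiField H f) x := by
  have hg := contDiffAt_gradient (hf.contDiffAt (x := x))
  have h1 : ContDiffAt ℝ 1 (fun y => H (gradient f y)) x :=
    ((hH.contDiffAt hx).of_le (by norm_num)).comp x hg
  exact (h1.smul contDiffAt_id).add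
    ((hg.inner ℝ contDiffAt_id).smul (hH.anisoNormal_contDiffAt hf hx))

lemma IsIpNorm.minkowskiField_hasFDerivAt (hH : IsIpNorm p H) (hf : ContDiff ℝ 2 f)
    (hx : gradient f x ≠ 0) : ∃ L : Euc N →L[ℝ] Euc N, HasFDerivAt (minkowskiField H f) L x ∧
      LinearMap.trace ℝ (Euc N) L =
        (N - 1) * H (gradient f x) - anisoCurv H f x * ⟪gradient f x, x⟫ := by
  set F := fderiv ℝ (gradient f) x with hF
  have hg : HasFDerivAt (gradient f) F x :=
    ((contDiffAt_gradient hf.contDiffAt).differentiableAt (by norm_num)).hasFDerivAt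
  have hZ : HasFDerivAt (anisoNormal H f) (fderiv ℝ (anisoNormal H f) x) x :=
    (hH.anisoNormal_hasFDerivAt hf hx).differentiableAt.hasFDerivAt
  have h1 : HasFDerivAt (fun y => H (gradient f y)) _ x :=
    (hH.hasGradientAt hx).hasFDerivAt.comp x hg
  have h2 : HasFDerivAt (fun y => ⟪gradient f y, y⟫) _ x := hg.inner ℝ (hasFDerivAt_id x)
  have h3 : HasFDerivAt (fun y => H (gradient f y) • y) _ x := h1.smul (hasFDerivAt_id x)
  have h4 : HasFDerivAt (fun y => ⟪gradient f y, y⟫ • anisoNormal H f y) _ x := h2.smul hZ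
  have h5 : HasFDerivAt (minkowskiField H f) _ x := h3.add h4
  refine ⟨_, h5, ?_⟩
  have hZt : LinearMap.trace ℝ (Euc N) (fderiv ℝ (anisoNormal H f) x : Euc N →L[ℝ] Euc N) =
      -anisoCurv H f x := by
    rw [anisoCurv, divVF_eq_trace hZ, neg_neg]
  have hsymm : ⟪F (gradient H (gradient f x)), x⟫ = ⟪gradient H (gradient f x), F x⟫ := by
    rw [inner_fderiv_gradient_comm hf.contDiffAt, real_inner_comm]
  simp only [ContinuousLinearMap.toLinearMap_add, ContinuousLinearMap.toLinearMap_smul, map_add,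
    map_smul, trace_smulRight_clm, hZt]
  rw [hH.anisoNormal_eq hx]
  have hself : fderiv ℝ f x (gradient H (gradient f x)) = H (gradient f x) := by
    rw [← gradient_inner_eq, real_inner_comm, hH.inner_gradient_self hx]
  simp [hsymm, inner_neg_left, real_inner_comm _ (gradient f x), hself]
  ring

end Fields

/-- A weight function on levels of `f` supported in the shell `-ε < s < 0`. -/
structure IsShellWeight (ε : ℝ) (η : ℝ → ℝ) : Prop where
  contDiff : ContDiff ℝ 1 η
  nonneg : ∀ s, 0 ≤ η s
  le_one : ∀ s, η s ≤ 1
  eq_zero_of_le : ∀ s ≤ -ε, η s = 0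
  eq_zero_of_nonneg : ∀ s, 0 ≤ s → η s = 0

namespace IsShellWeight

variable {ε : ℝ} {η : ℝ → ℝ}

lemma mem_Ioo (h : IsShellWeight ε η) {s : ℝ} (hs : η s ≠ 0) : s ∈ Ioo (-ε) 0 :=
  ⟨not_le.1 fun h1 => hs (h.eq_zero_of_le s h1), not_le.1 fun h1 => hs (h.eq_zero_of_nonneg s h1)⟩

lemma eventually_eq_zero (h : IsShellWeight ε η) (hf : Continuous f) {x : Euc N}
    (hx : f x ∉ Icc (-ε) 0) : ∀ᶠ y in 𝓝 x, η (f y) = 0 := by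
  have h1 : ∀ᶠ y in 𝓝 x, f y ∈ (Icc (-ε) 0)ᶜ :=
    hf.continuousAt.eventually (isClosed_Icc.isOpen_compl.mem_nhds hx)
  filter_upwards [h1] with y hy
  by_contra h0
  exact hy (Ioo_subset_Icc_self (h.mem_Ioo h0))

/-- Anisotropic Minkowski formula averaged over level sets. -/
lemma integral_minkowski (h : IsShellWeight ε η) (hH : IsIpNorm p H) (hf : ContDiff ℝ 2 f)
    (hK : IsCompact {x | f x ≤ 0}) (hg : ∀ x, f x ∈ Icc (-ε) 0 → gradient f x ≠ 0) :
    Integrable (fun x =>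
      η (f x) * ((N - 1) * H (gradient f x) - anisoCurv H f x * ⟪gradient f x, x⟫)) ∧
    ∫ x, η (f x) * ((N - 1) * H (gradient f x) - anisoCurv H f x * ⟪gradient f x, x⟫) = 0 := by
  have hηf : ContDiff ℝ 1 fun x => η (f x) := h.contDiff.comp (hf.of_le (by norm_num))
  set X : Euc N → Euc N := fun x => η (f x) • minkowskiField H f x with hX
  have hloc : ∀ x, f x ∉ Icc (-ε) 0 → X =ᶠ[𝓝 x] fun _ => 0 := by
    intro x hx
    filter_upwards [h.eventually_eq_zero hf.continuous hx] with y hy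
    simp only [hX, hy, zero_smul]
  have hXc : ContDiff ℝ 1 X := by
    rw [contDiff_iff_contDiffAt]
    intro x
    by_cases hx : f x ∈ Icc (-ε) 0
    · exact hηf.contDiffAt.smul (hH.minkowskiField_contDiffAt hf (hg x hx))
    · exact contDiffAt_const.congr_of_eventuallyEq (hloc x hx)
  have hXs : HasCompactSupport X := by
    refine HasCompactSupport.intro hK fun x hx => ?_
    have : 0 ≤ f x := (not_le.1 hx).le
    simp only [hX, h.eq_zero_of_nonneg _ this, zero_smul]
  suffices h0 : divVF X = fun x =>
      η (f x) * ((N - 1) * H (gradient f x) - anisoCurv H f x * ⟪gradient f x, x⟫) by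
    rw [← h0]
    exact ⟨integrable_divVF hXc hXs, integral_divVF_eq_zero hXc hXs⟩
  ext x
  by_cases hx : f x ∈ Icc (-ε) 0
  · obtain ⟨L, hL, hLt⟩ := hH.minkowskiField_hasFDerivAt hf (hg x hx)
    have h1 := (hηf.differentiable (by norm_num) x).hasFDerivAt
    have h2 : HasFDerivAt X _ x := h1.smul hL
    have h3 : fderiv ℝ (fun x => η (f x)) x (minkowskiField H f x) = 0 := by
      have h4 : HasFDerivAt (fun x => η (f x)) _ x :=
        (h.contDiff.differentiable (by norm_num) (f x)).hasDerivAt.comp_hasFDerivAt x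
          (hf.differentiable (by norm_num) x).hasFDerivAt
      rw [h4.fderiv, smul_apply, ← gradient_inner_eq,
        hH.inner_gradient_minkowskiField (hg x hx), smul_zero]
    rw [divVF_eq_trace h2]
    simp only [ContinuousLinearMap.toLinearMap_add, ContinuousLinearMap.toLinearMap_smul, map_add,
      map_smul, trace_smulRight_clm, h3, hLt, add_zero, smul_eq_mul]
  · have h1 : HasFDerivAt X 0 x :=
      (hasFDerivAt_const (𝕜 := ℝ) 0 x).congr_of_eventuallyEq (hloc x hx)
    rw [divVF_eq_trace h1, (h.eventually_eq_zero hf.continuous hx).self_of_nhds]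
    simp

/-- The primitive of a shell weight vanishing at level zero. -/
lemma exists_primitive (h : IsShellWeight ε η) (hε : 0 < ε) : ∃ E : ℝ → ℝ,
    (∀ s, HasDerivAt E (-η s) s) ∧ (∀ s, 0 ≤ s → E s = 0) ∧ (∀ s, 0 ≤ E s) ∧ ∀ s, E s ≤ ε := by
  have hc := h.contDiff.continuous
  have hi : ∀ a b, IntervalIntegrable η volume a b := fun a b => hc.intervalIntegrable a b
  have h0 : ∀ s, 0 ≤ s → ∫ u in s..0, η u = 0 := by
    intro s hs
    rw [intervalIntegral.integral_symm, intervalIntegral.integral_congr (g := fun _ => 0)]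
    · simp
    · intro u hu
      rw [uIcc_of_le hs] at hu
      exact h.eq_zero_of_nonneg u hu.1
  refine ⟨fun s => ∫ u in s..0, η u, fun s => ?_, h0, fun s => ?_, fun s => ?_⟩
  · exact intervalIntegral.integral_hasDerivAt_left (hi s 0)
      hc.stronglyMeasurable.stronglyMeasurableAtFilter hc.continuousAt
  · rcases le_total 0 s with hs | hs
    · exact (h0 s hs).ge
    · exact intervalIntegral.integral_nonneg hs fun u _ => h.nonneg u
  · rcases le_total 0 s with hs | hs
    · simp only [h0 s hs]; exact hε.le
    rcases le_total s (-ε) with hs' | hs'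
    · have h1 : ∫ u in s..(-ε), η u = 0 := by
        rw [intervalIntegral.integral_congr (g := fun _ => 0)]
        · simp
        · intro u hu
          rw [uIcc_of_le hs'] at hu
          exact h.eq_zero_of_le u hu.2
      have h2 : ∫ u in (-ε)..0, η u ≤ ∫ u in (-ε)..0, (1 : ℝ) :=
        intervalIntegral.integral_mono_on (by linarith) (hi _ _) (by simp) fun u _ => h.le_one u
      simp only [← intervalIntegral.integral_add_adjacent_intervals (hi s (-ε)) (hi (-ε) 0), h1]
      simp at h2
      linarith
    · have h2 : ∫ u in s..0, η u ≤ ∫ u in s..0, (1 : ℝ) :=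
        intervalIntegral.integral_mono_on hs (hi _ _) (by simp) fun u _ => h.le_one u
      simp at h2
      simp only
      linarith

/-- The averaged volume identity `∫ η(f) ⟪∇f, x⟫ = N ∫ E(f)`. -/
lemma integral_inner_gradient (h : IsShellWeight ε η) (hε : 0 < ε) (hf : ContDiff ℝ 2 f)
    (hK : IsCompact {x | f x ≤ 0}) :
    0 ≤ ∫ x, η (f x) * ⟪gradient f x, x⟫ ∧
      ∫ x, η (f x) * ⟪gradient f x, x⟫ ≤ N * (ε * volume.real {x | f x < 0}) := by
  obtain ⟨E, hE, hE0, hEn, hEε⟩ := h.exists_primitive hε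
  have hEc : ContDiff ℝ 1 E := by
    rw [contDiff_one_iff_deriv]
    refine ⟨fun s => (hE s).differentiableAt, ?_⟩
    have : deriv E = fun s => -η s := funext fun s => (hE s).deriv
    rw [this]
    exact h.contDiff.continuous.neg
  have hf1 : ContDiff ℝ 1 f := hf.of_le (by norm_num)
  set X : Euc N → Euc N := fun x => E (f x) • x with hX
  have hXc : ContDiff ℝ 1 X := (hEc.comp hf1).smul contDiff_id
  have hEs : HasCompactSupport fun x => E (f x) := by
    refine HasCompactSupport.intro hK fun x hx => ?_
    exact hE0 _ (not_le.1 hx).le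
  have hηs : HasCompactSupport fun x => η (f x) := by
    refine HasCompactSupport.intro hK fun x hx => ?_
    exact h.eq_zero_of_nonneg _ (not_le.1 hx).le
  have hXs : HasCompactSupport X := hEs.smul_right
  have hdiv : ∀ x, divVF X x = N * E (f x) - η (f x) * ⟪gradient f x, x⟫ := by
    intro x
    have h4 : HasFDerivAt (fun x => E (f x)) _ x :=
      (hE (f x)).comp_hasFDerivAt x (hf.differentiable (by norm_num) x).hasFDerivAt
    have h2 : HasFDerivAt X _ x := h4.smul (hasFDerivAt_id x)
    rw [divVF_eq_trace h2]
    simp only [ContinuousLinearMap.toLinearMap_add, ContinuousLinearMap.toLinearMap_smul, map_add,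
      map_smul, trace_smulRight_clm, gradient_inner_eq]
    simp
    ring
  have hi1 : Integrable fun x => N * E (f x) :=
    ((hEc.continuous.comp hf.continuous).integrable_of_hasCompactSupport hEs).const_mul _
  have hi2 : Integrable fun x => η (f x) * ⟪gradient f x, x⟫ :=
    ((h.contDiff.continuous.comp hf.continuous).mul
      ((continuous_gradient hf).inner continuous_id)).integrable_of_hasCompactSupport
      hηs.mul_right
  have h1 := integral_divVF_eq_zero hXc hXs
  simp only [hdiv] at h1
  rw [integral_sub hi1 hi2, sub_eq_zero, integral_const_mul] at h1
  rw [← h1]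
  refine ⟨mul_nonneg (Nat.cast_nonneg _) (integral_nonneg fun x => hEn _), ?_⟩
  refine mul_le_mul_of_nonneg_left ?_ (Nat.cast_nonneg _)
  have hm : MeasurableSet {x | f x < 0} :=
    measurableSet_lt hf.continuous.measurable measurable_const
  have hfin : volume {x | f x < 0} ≠ ⊤ :=
    ((measure_mono fun x (hx : f x < 0) => hx.le).trans_lt hK.measure_lt_top).ne
  calc ∫ x, E (f x) ≤ ∫ x, {x | f x < 0}.indicator (fun _ => ε) x := by
        refine integral_mono ((hEc.continuous.comp hf.continuous).integrable_of_hasCompactSupport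
          hEs) ((integrable_indicator_iff hm).2 (integrableOn_const hfin)) fun x => ?_
        by_cases hx : f x < 0
        · simpa [hx] using hEε _
        · simpa [hx] using (hE0 _ (not_lt.1 hx)).le
    _ = _ := by
        rw [integral_indicator hm]
        simp [mul_comm]

end IsShellWeight

end

section

variable {N : ℕ} {p : ℝ} {H f : Euc N → ℝ} {ε : ℝ}

namespace IsShellWeight

variable {η : ℝ → ℝ}

lemma integral_le (h : IsShellWeight ε η) (hε : 0 < ε) (hH : IsIpNorm p H) (hf : ContDiff ℝ 2 f)
    (hK : IsCompact {x | f x ≤ 0}) (hg : ∀ x, f x ∈ Icc (-ε) 0 → gradient f x ≠ 0) {c ω C : ℝ}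
    (hω : ∀ x, f x ∈ Icc (-ε) 0 → |anisoCurv H f x - c| ≤ ω)
    (hC : ∀ x, f x ∈ Icc (-ε) 0 → |⟪gradient f x, x⟫| ≤ C * H (gradient f x)) :
    (N - 1 - ω * C) * ∫ x, η (f x) * H (gradient f x) ≤
      max c 0 * (N * (ε * volume.real {x | f x < 0})) := by
  obtain ⟨hi, h0⟩ := h.integral_minkowski hH hf hK hg
  obtain ⟨h1, h2⟩ := h.integral_inner_gradient hε hf hK
  have hηs : HasCompactSupport fun x => η (f x) := by
    refine HasCompactSupport.intro hK fun x hx => ?_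
    exact h.eq_zero_of_nonneg _ (not_le.1 hx).le
  have hηc : Continuous fun x => η (f x) := h.contDiff.continuous.comp hf.continuous
  have hi1 : Integrable fun x => η (f x) * H (gradient f x) :=
    (hηc.mul (hH.continuous.comp (continuous_gradient hf))).integrable_of_hasCompactSupport
      hηs.mul_right
  have hi2 : Integrable fun x => η (f x) * ⟪gradient f x, x⟫ :=
    (hηc.mul ((continuous_gradient hf).inner continuous_id)).integrable_of_hasCompactSupport
      hηs.mul_right
  have h3 : ∫ x, ((N - 1 - ω * C) * (η (f x) * H (gradient f x)) -
      c * (η (f x) * ⟪gradient f x, x⟫)) ≤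
      ∫ x, η (f x) * ((N - 1) * H (gradient f x) - anisoCurv H f x * ⟪gradient f x, x⟫) := by
    refine integral_mono ((hi1.const_mul _).sub (hi2.const_mul _)) hi fun x => ?_
    by_cases hx : η (f x) = 0
    · simp [hx]
    have hx' := Ioo_subset_Icc_self (h.mem_Ioo hx)
    have h4 : (anisoCurv H f x - c) * ⟪gradient f x, x⟫ ≤ ω * (C * H (gradient f x)) :=
      (le_abs_self _).trans (by
        rw [abs_mul]
        exact mul_le_mul (hω x hx') (hC x hx') (abs_nonneg _) ((abs_nonneg _).trans (hω x hx')))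
    have h5 := mul_le_mul_of_nonneg_left h4 (h.nonneg (f x))
    simp only
    nlinarith
  rw [h0, integral_sub (hi1.const_mul _) (hi2.const_mul _), integral_const_mul,
    integral_const_mul] at h3
  have h6 : c * ∫ x, η (f x) * ⟪gradient f x, x⟫ ≤
      max c 0 * (N * (ε * volume.real {x | f x < 0})) :=
    (mul_le_mul_of_nonneg_right (le_max_left c 0) h1).trans
      (mul_le_mul_of_nonneg_left h2 (le_max_right c 0))
  linarith

end IsShellWeight

lemma isShellWeight_smoothTransition (k : ℕ) :
    IsShellWeight ε fun s =>
      Real.smoothTransition (k * (s + ε)) * Real.smoothTransition (-(k * s)) where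
  contDiff := by
    have h : ContDiff ℝ 1 Real.smoothTransition := Real.smoothTransition.contDiff (n := 1)
    exact (h.comp (by fun_prop)).mul (h.comp (by fun_prop))
  nonneg s := mul_nonneg (Real.smoothTransition.nonneg _) (Real.smoothTransition.nonneg _)
  le_one s := mul_le_one₀ (Real.smoothTransition.le_one _) (Real.smoothTransition.nonneg _)
    (Real.smoothTransition.le_one _)
  eq_zero_of_le s hs := by
    rw [Real.smoothTransition.zero_of_nonpos, zero_mul]
    exact mul_nonpos_of_nonneg_of_nonpos (Nat.cast_nonneg _) (by linarith)
  eq_zero_of_nonneg s hs := by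
    rw [Real.smoothTransition.zero_of_nonpos (x := -(k * s)), mul_zero]
    exact neg_nonpos.2 (mul_nonneg (Nat.cast_nonneg _) hs)

lemma tendsto_shellWeight (s : ℝ) :
    Tendsto (fun k : ℕ => Real.smoothTransition (k * (s + ε)) * Real.smoothTransition (-(k * s)))
      atTop (𝓝 ((Ioo (-ε) 0).indicator 1 s)) := by
  by_cases hs : s ∈ Ioo (-ε) 0
  · rw [indicator_of_mem hs]
    refine tendsto_const_nhds.congr' ?_
    have h1 : Tendsto (fun k : ℕ => (k : ℝ) * (s + ε)) atTop atTop :=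
      tendsto_natCast_atTop_atTop.atTop_mul_const (by linarith [hs.1])
    have h2 : Tendsto (fun k : ℕ => (k : ℝ) * (-s)) atTop atTop :=
      tendsto_natCast_atTop_atTop.atTop_mul_const (by linarith [hs.2])
    filter_upwards [h1.eventually_ge_atTop 1, h2.eventually_ge_atTop 1] with k hk1 hk2
    rw [Real.smoothTransition.one_of_one_le hk1, Real.smoothTransition.one_of_one_le (by linarith)]
    simp
  · rw [indicator_of_notMem hs]
    refine tendsto_const_nhds.congr fun k => ?_
    by_contra h0
    exact hs ((isShellWeight_smoothTransition (ε := ε) k).mem_Ioo (Ne.symm h0))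

/-- Upper bound for the anisotropic area of a thin shell. -/
lemma shell_integral_le (hε : 0 < ε) (hH : IsIpNorm p H) (hf : ContDiff ℝ 2 f)
    (hK : IsCompact {x | f x ≤ 0}) (hg : ∀ x, f x ∈ Icc (-ε) 0 → gradient f x ≠ 0) {c ω C : ℝ}
    (hω : ∀ x, f x ∈ Icc (-ε) 0 → |anisoCurv H f x - c| ≤ ω)
    (hC : ∀ x, f x ∈ Icc (-ε) 0 → |⟪gradient f x, x⟫| ≤ C * H (gradient f x)) :
    (N - 1 - ω * C) * ∫ x in {x | f x ∈ Ioo (-ε) 0}, H (gradient f x) ≤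
      max c 0 * (N * (ε * volume.real {x | f x < 0})) := by
  have hHc : Continuous fun x => H (gradient f x) := hH.continuous.comp (continuous_gradient hf)
  have hm : MeasurableSet {x | f x ∈ Ioo (-ε) 0} := hf.continuous.measurable measurableSet_Ioo
  have hlim : Tendsto (fun k : ℕ => ∫ x, (Real.smoothTransition (k * (f x + ε)) *
      Real.smoothTransition (-(k * f x))) * H (gradient f x)) atTop
      (𝓝 (∫ x in {x | f x ∈ Ioo (-ε) 0}, H (gradient f x))) := by
    rw [← integral_indicator hm]
    refine tendsto_integral_of_dominated_convergence
      ({x | f x ≤ 0}.indicator fun x => H (gradient f x)) (fun k => ?_) ?_ (fun k => ?_) ?_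
    · exact (((isShellWeight_smoothTransition (ε := ε) k).contDiff.continuous.comp
        hf.continuous).mul hHc).aestronglyMeasurable
    · exact (integrable_indicator_iff hK.measurableSet).2 (hHc.continuousOn.integrableOn_compact hK)
    · refine Eventually.of_forall fun x => ?_
      have hw := isShellWeight_smoothTransition (ε := ε) k
      by_cases hx : f x ≤ 0
      · rw [indicator_of_mem (show x ∈ {x | f x ≤ 0} from hx), norm_mul,
          Real.norm_of_nonneg (hw.nonneg _), Real.norm_of_nonneg (hH.nonneg _)]
        exact mul_le_of_le_one_left (hH.nonneg _) (hw.le_one _)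
      · rw [indicator_of_notMem (show x ∉ {x | f x ≤ 0} from hx)]
        have := hw.eq_zero_of_nonneg (f x) (not_le.1 hx).le
        rw [this, zero_mul, norm_zero]
    · refine Eventually.of_forall fun x => ?_
      have h1 := (tendsto_shellWeight (ε := ε) (f x)).mul_const (H (gradient f x))
      by_cases hx : f x ∈ Ioo (-ε) 0
      · rw [indicator_of_mem (show x ∈ {x | f x ∈ Ioo (-ε) 0} from hx)]
        simpa [indicator_of_mem hx] using h1
      · rw [indicator_of_notMem (show x ∉ {x | f x ∈ Ioo (-ε) 0} from hx)]
        simpa [indicator_of_notMem hx] using h1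
  exact le_of_tendsto (hlim.const_mul _) (Eventually.of_forall fun k =>
    (isShellWeight_smoothTransition (ε := ε) k).integral_le hε hH hf hK hg hω hC)

end

section

variable {N : ℕ} {p : ℝ} {H f : Euc N → ℝ} {ε c : ℝ} {x₀ : Euc N}

lemma exists_shell_subset (hf : Continuous f) (hK : IsCompact {x | f x ≤ 0}) {U : Set (Euc N)}
    (hU : IsOpen U) (h : ∀ x, f x = 0 → x ∈ U) :
    ∃ ε > 0, ∀ x, f x ∈ Icc (-ε) 0 → x ∈ U := by
  rcases ({x | f x ≤ 0} \ U).eq_empty_or_nonempty with he | hne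
  · refine ⟨1, one_pos, fun x hx => ?_⟩
    by_contra hxU
    exact notMem_empty x (he ▸ ⟨hx.2, hxU⟩)
  · obtain ⟨m, hm, hmax⟩ := (hK.diff hU).exists_isMaxOn hne hf.continuousOn
    have hm0 : f m < 0 := lt_of_le_of_ne hm.1 fun h0 => hm.2 (h m h0)
    refine ⟨-(f m / 2), by linarith, fun x hx => ?_⟩
    by_contra hxU
    have h1 : f x ≤ f m := hmax (show x ∈ {x | f x ≤ 0} \ U from ⟨hx.2, hxU⟩)
    have h2 := hx.1
    linarith

lemma IsIpNorm.exists_shell (hH : IsIpNorm p H) (hf : ContDiff ℝ 2 f)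
    (hK : IsCompact {x | f x ≤ 0}) (hg : ∀ x, f x = 0 → gradient f x ≠ 0)
    (hc : ∀ x, f x = 0 → anisoCurv H f x = c) {ω : ℝ} (hω : 0 < ω) :
    ∃ ε > 0, ∀ x, f x ∈ Icc (-ε) 0 → gradient f x ≠ 0 ∧ |anisoCurv H f x - c| ≤ ω := by
  have hU : IsOpen {x | gradient f x ≠ 0 ∧ |anisoCurv H f x - c| < ω} := by
    rw [isOpen_iff_mem_nhds]
    rintro x ⟨hx, hxc⟩
    have h1 : ContinuousAt (fun x => |anisoCurv H f x - c|) x :=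
      ((hH.anisoCurv_continuousAt hf hx).sub continuousAt_const).abs
    filter_upwards [(isOpen_gradient_ne_zero hf).mem_nhds hx, h1.eventually_lt_const hxc]
      with y h2 h3
    exact ⟨h2, h3⟩
  obtain ⟨ε, hε, h⟩ := exists_shell_subset hf.continuous hK hU fun x hx =>
    ⟨hg x hx, by rw [hc x hx]; simpa using hω⟩
  exact ⟨ε, hε, fun x hx => ⟨(h x hx).1, (h x hx).2.le⟩⟩

lemma IsIpNorm.exists_abs_inner_le (hH : IsIpNorm p H) (hK : IsCompact {x | f x ≤ 0}) :
    ∃ C > 0, ∀ x, f x ≤ 0 → |⟪gradient f x, x⟫| ≤ C * H (gradient f x) := by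
  obtain ⟨m, hm, hmH⟩ := hH.exists_lower
  obtain ⟨R, hR, hRK⟩ := hK.isBounded.exists_pos_norm_le
  refine ⟨R / m, by positivity, fun x hx => ?_⟩
  calc |⟪gradient f x, x⟫| ≤ ‖gradient f x‖ * ‖x‖ := abs_real_inner_le_norm _ _
    _ ≤ ‖gradient f x‖ * R := mul_le_mul_of_nonneg_left (hRK x hx) (norm_nonneg _)
    _ = R / m * (m * ‖gradient f x‖) := by field_simp
    _ ≤ R / m * H (gradient f x) := mul_le_mul_of_nonneg_left (hmH _) (by positivity)

lemma IsIpNorm.integrableOn_shell (hH : IsIpNorm p H) (hf : ContDiff ℝ 2 f)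
    (hK : IsCompact {x | f x ≤ 0}) {S : Set (Euc N)} (hS : ∀ x ∈ S, f x ≤ 0) :
    IntegrableOn (fun x => H (gradient f x)) S :=
  (((hH.continuous.comp (continuous_gradient hf)).continuousOn).integrableOn_compact hK).mono_set hS

lemma IsIpNorm.shell_integral_pos (hH : IsIpNorm p H) (hf : ContDiff ℝ 2 f)
    (hK : IsCompact {x | f x ≤ 0}) (hε : 0 < ε)
    (hg : ∀ x, f x ∈ Icc (-ε) 0 → gradient f x ≠ 0) (hx₀ : f x₀ = 0)
    (hcl : x₀ ∈ closure {x | f x < 0}) :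
    0 < ∫ x in {x | f x ∈ Ioo (-ε) 0}, H (gradient f x) := by
  have ho : IsOpen {x | f x ∈ Ioo (-ε) 0} := isOpen_Ioo.preimage hf.continuous
  rw [setIntegral_pos_iff_support_of_nonneg_ae
    (Eventually.of_forall fun x => hH.nonneg _)
    (hH.integrableOn_shell hf hK (S := {x | f x ∈ Ioo (-ε) 0}) fun x hx => hx.2.le)]
  have hss : {x | f x ∈ Ioo (-ε) 0} ⊆ Function.support (fun x => H (gradient f x)) ∩
      {x | f x ∈ Ioo (-ε) 0} := fun x hx =>
    ⟨(hH.pos _ (hg x (Ioo_subset_Icc_self hx))).ne', hx⟩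
  refine lt_of_lt_of_le (ho.measure_pos volume ?_) (measure_mono hss)
  obtain ⟨z, hz1, hz2⟩ := mem_closure_iff.1 hcl {x | -ε < f x}
    (isOpen_lt continuous_const hf.continuous) (by simp [hx₀, hε])
  exact ⟨z, hz1, hz2⟩

lemma IsIpNorm.curv_pos (hH : IsIpNorm p H) (hN : 2 ≤ N) (hf : ContDiff ℝ 2 f)
    (hK : IsCompact {x | f x ≤ 0}) (hg : ∀ x, f x = 0 → gradient f x ≠ 0)
    (hc : ∀ x, f x = 0 → anisoCurv H f x = c) (hx₀ : f x₀ = 0)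
    (hcl : x₀ ∈ closure {x | f x < 0}) : 0 < c := by
  by_contra! hc0
  obtain ⟨C, hC, hCb⟩ := hH.exists_abs_inner_le hK
  obtain ⟨ε, hε, hsh⟩ := hH.exists_shell hf hK hg hc (ω := 1 / (2 * C)) (by positivity)
  have h1 := hH.shell_integral_pos hf hK hε (fun x hx => (hsh x hx).1) hx₀ hcl
  have h2 := shell_integral_le hε hH hf hK (fun x hx => (hsh x hx).1) (fun x hx => (hsh x hx).2)
    (fun x hx => hCb x hx.2)
  rw [max_eq_right hc0, zero_mul] at h2
  have h3 : 1 / (2 * C) * C = 1 / 2 := by field_simp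
  have h4 : (2 : ℝ) ≤ N := by exact_mod_cast hN
  rw [h3] at h2
  nlinarith

lemma IsIpNorm.exists_touchesAt (hH : IsIpNorm p H) (hf : ContDiff ℝ 2 f) {y : Euc N} {s : ℝ}
    (hx₀ : f x₀ = 0) (hs : s ≤ 0) (hy : f y < s) (hg : ∀ x, f x = s → gradient f x ≠ 0) :
    ∃ x t, TouchesAt H f x y t ∧ f x = s ∧ (∀ z, dualNorm H (z - y) < t → f z < s) ∧
      dualNorm H (x - y) ≤ dualNorm H (x₀ - y) := by
  obtain ⟨x, hpos, hxs, hlt⟩ := hH.exists_nearest hf.continuous ⟨x₀, by rw [hx₀]; exact hs⟩ hy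
  refine ⟨x, _, ⟨hpos, rfl, fun z hz => ((hlt z hz).trans_eq hxs.symm).le, hg x hxs⟩, hxs, hlt, ?_⟩
  by_contra! h
  exact absurd (hlt x₀ h) (by rw [hx₀]; exact not_lt.2 hs)

lemma IsIpNorm.mul_volume_le (hH : IsIpNorm p H) (hN : 2 ≤ N) (hf : ContDiff ℝ 2 f)
    (hK : IsCompact {x | f x ≤ 0}) (hε : 0 < ε) {r T : ℝ} (hr : 0 < r) (hT : 0 ≤ T) (hTr : T ≤ r)
    (hg : ∀ x, f x ∈ Icc (-ε) 0 → gradient f x ≠ 0)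
    (hcurv : ∀ x, f x ∈ Icc (-ε) 0 → (N - 1 : ℕ) / r ≤ anisoCurv H f x)
    (hx₀ : f x₀ = 0) {U A : Set (Euc N)} (hU : MeasurableSet U)
    (hUT : ∀ x ∈ U, f x ≤ 0 → gradient f x ≠ 0 → ∀ t, 0 < t → t ≤ r →
      (∀ z, dualNorm H (z - (x + t • anisoNormal H f x)) < t → f z < 0) → t ≤ T)
    (hA : ∀ y ∈ A, ∀ x, dualNorm H (x - y) ≤ dualNorm H (x₀ - y) → x ∈ U) :
    ε * volume.real {x | f x < -ε} ≤ r / N *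
      ((∫ x in {x | f x ∈ Ioo (-ε) 0}, H (gradient f x)) -
        (1 - T / r) ^ N * ∫ x in {x | f x ∈ Ioo (-ε) 0} ∩ U, H (gradient f x)) ∧
    ε * volume.real ({x | f x < -ε} ∩ A) ≤
      r / N * ∫ x in {x | f x ∈ Ioo (-ε) 0} ∩ U, H (gradient f x) := by
  set S : Set (Euc N) := {x | f x ∈ Ioo (-ε) 0} with hS
  have hSm : MeasurableSet S := hf.continuous.measurable measurableSet_Ioo
  have hN0 : (0 : ℝ) < N := by exact_mod_cast (by omega : 0 < N)
  have hn0 : (0 : ℝ) < (N - 1 : ℕ) := by exact_mod_cast (by omega : 0 < N - 1)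
  have hS0 : ∀ x ∈ S, f x ∈ Icc (-ε) 0 := fun x hx => Ioo_subset_Icc_self hx
  have hler : ∀ x y t, x ∈ S → TouchesAt H f x y t → t ≤ r := by
    intro x y t hx ht
    have h1 := (ht.mul_curv_le_and_abs_det_le hH hN hf).1
    have h2 := mul_le_mul_of_nonneg_left (hcurv x (hS0 x hx)) ht.pos.le
    have h3 : t * (N - 1 : ℕ) ≤ (N - 1 : ℕ) * r := by
      have := h2.trans h1
      rw [mul_div_assoc', div_le_iff₀ hr] at this
      exact this
    nlinarith
  have hkey : ∀ y s, f y < -ε → s ∈ Ioo (-ε) 0 → ∃ x ∈ S, ∃ t ≤ r, TouchesAt H f x y t ∧ f x = s ∧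
      (x ∈ U → t ≤ T) ∧ (y ∈ A → x ∈ U) := by
    intro y s hy hs
    obtain ⟨x, t, ht, hxs, hlt, hle⟩ := hH.exists_touchesAt hf hx₀ hs.2.le (hy.trans hs.1)
      (fun x hx => hg x (by rw [hx]; exact Ioo_subset_Icc_self hs))
    have hxS : x ∈ S := by rw [hS, mem_ofPred_eq, hxs]; exact hs
    refine ⟨x, hxS, t, hler x y t hxS ht, ht, hxs, fun hxU => ?_, fun hyA => hA y hyA x hle⟩
    refine hUT x hxU (hS0 x hxS).2 ht.ne_zero t ht.pos (hler x y t hxS ht) fun z hz => ?_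
    rw [← ht.center_eq hH hf] at hz
    exact (hlt z hz).trans hs.2
  have hint : ∀ S' ⊆ S, ∫⁻ x in S', ENNReal.ofReal (H (gradient f x)) =
      ENNReal.ofReal (∫ x in S', H (gradient f x)) := fun S' hS' =>
    (ofReal_integral_eq_lintegral_ofReal
      (hH.integrableOn_shell hf hK fun x hx => (hS0 x (hS' hx)).2)
      (Eventually.of_forall fun x => hH.nonneg _)).symm
  have hi0 : ∀ S' : Set (Euc N), 0 ≤ ∫ x in S', H (gradient f x) := fun S' =>
    integral_nonneg fun x => hH.nonneg _
  have hprod : ∀ B ⊆ {x | f x < -ε}, volume (B ×ˢ Ioo (-ε) 0) =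
      ENNReal.ofReal (ε * volume.real B) := by
    intro B hB
    have hfin : volume B ≠ ⊤ := ((measure_mono (hB.trans fun x (hx : f x < -ε) =>
      (show f x ≤ 0 by linarith))).trans_lt hK.measure_lt_top).ne
    rw [Measure.volume_eq_prod, Measure.prod_prod, Real.volume_Ioo, measureReal_def,
      ENNReal.ofReal_mul hε.le, ENNReal.ofReal_toReal hfin, mul_comm]
    simp
  have hvol : ∀ (S' : Set (Euc N)) (hS' : S' ⊆ S) (hm : MeasurableSet S') (T' : ℝ) (h0 : 0 ≤ T')
      (hT' : T' ≤ r) (P : Set (Euc N × ℝ)) (hP : ∀ y s, (y, s) ∈ P → ∃ x ∈ S', ∃ t ≤ T',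
        TouchesAt H f x y t ∧ f x = s), volume P ≤
      ENNReal.ofReal ((∫ x in S', H (gradient f x)) * (r / N * (1 - (1 - T' / r) ^ N))) := by
    intro S' hS' hm T' h0 hT' P hP
    have := hH.volume_le_of_touchesAt hN hf hm (fun x hx => hg x (hS0 x (hS' hx))) hr h0 hT'
      (fun x hx => hcurv x (hS0 x (hS' hx))) hP
    rwa [hint S' hS', ← ENNReal.ofReal_mul (hi0 _)] at this
  have hTr1 : 0 ≤ 1 - T / r := by rw [sub_nonneg, div_le_one hr]; exact hTr
  have hTr2 : (1 - T / r) ^ N ≤ 1 :=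
    pow_le_one₀ hTr1 (by linarith [div_nonneg hT hr.le])
  have hrr : (1 - r / r : ℝ) ^ N = 0 := by
    rw [div_self hr.ne', sub_self, zero_pow (by omega)]
  constructor
  · set P : Set (Euc N × ℝ) := {x | f x < -ε} ×ˢ Ioo (-ε) 0
    set P₁ : Set (Euc N × ℝ) := {q | ∃ x ∈ S ∩ U, ∃ t ≤ T, TouchesAt H f x q.1 t ∧ f x = q.2}
    set P₂ : Set (Euc N × ℝ) := {q | ∃ x ∈ S \ U, ∃ t ≤ r, TouchesAt H f x q.1 t ∧ f x = q.2}
    have hPP : P ⊆ P₁ ∪ P₂ := by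
      rintro ⟨y, s⟩ ⟨hy, hs⟩
      obtain ⟨x, hxS, t, htr, ht, hxs, h1, -⟩ := hkey y s hy hs
      by_cases hxU : x ∈ U
      · exact Or.inl ⟨x, ⟨hxS, hxU⟩, t, h1 hxU, ht, hxs⟩
      · exact Or.inr ⟨x, ⟨hxS, hxU⟩, t, htr, ht, hxs⟩
    have h1 := hvol (S ∩ U) inter_subset_left (hSm.inter hU) T hT hTr P₁ fun y s h => h
    have h2 := hvol (S \ U) sdiff_subset (hSm.diff hU) r hr.le le_rfl P₂ fun y s h => h
    have h3 := ((measure_mono hPP).trans (measure_union_le _ _)).trans (add_le_add h1 h2)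
    have hsum := integral_inter_add_sdiff (μ := volume) hU
      (hH.integrableOn_shell hf hK (S := S) fun x hx => (hS0 x hx).2)
    have hq : 0 ≤ r / N * (1 - (1 - T / r) ^ N) :=
      mul_nonneg (by positivity) (by linarith)
    have hq2 : 0 ≤ r / N * (1 - (1 - r / r) ^ N) := by rw [hrr]; simp; positivity
    rw [hprod _ subset_rfl, ← ENNReal.ofReal_add (mul_nonneg (hi0 _) hq) (mul_nonneg (hi0 _) hq2),
      ENNReal.ofReal_le_ofReal_iff (add_nonneg (mul_nonneg (hi0 _) hq) (mul_nonneg (hi0 _) hq2)),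
      hrr] at h3
    rw [← hsum]
    refine h3.trans_eq ?_
    ring
  · set P : Set (Euc N × ℝ) := ({x | f x < -ε} ∩ A) ×ˢ Ioo (-ε) 0
    have h1 := hvol (S ∩ U) inter_subset_left (hSm.inter hU) r hr.le le_rfl P (by
      rintro y s ⟨⟨hy, hyA⟩, hs⟩
      obtain ⟨x, hxS, t, htr, ht, hxs, -, h2⟩ := hkey y s hy hs
      exact ⟨x, ⟨hxS, h2 hyA⟩, t, htr, ht, hxs⟩)
    rw [hprod _ inter_subset_left, hrr, ENNReal.ofReal_le_ofReal_iff
      (mul_nonneg (hi0 _) (by simp; positivity))] at h1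
    refine h1.trans_eq ?_
    ring

end

section

variable {N : ℕ} {p : ℝ} {H f : Euc N → ℝ} {c : ℝ} {x₀ : Euc N}

lemma tendsto_volume_sublevel (hK : IsCompact {x | f x ≤ 0})
    (A : Set (Euc N)) :
    Tendsto (fun k : ℕ => volume.real ({x | f x < -(1 / ((k : ℝ) + 1))} ∩ A)) atTop
      (𝓝 (volume.real ({x | f x < 0} ∩ A))) := by
  have hmono : Monotone fun k : ℕ => {x | f x < -(1 / ((k : ℝ) + 1))} ∩ A := by
    intro j k hjk x hx
    have h1 : f x < -(1 / ((j : ℝ) + 1)) := hx.1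
    exact ⟨h1.trans_le (neg_le_neg (Nat.one_div_le_one_div hjk)), hx.2⟩
  have hU : ⋃ k : ℕ, {x | f x < -(1 / ((k : ℝ) + 1))} ∩ A = {x | f x < 0} ∩ A := by
    ext x
    simp only [mem_iUnion]
    constructor
    · rintro ⟨k, hk, hA⟩
      have h1 : f x < -(1 / ((k : ℝ) + 1)) := hk
      exact ⟨h1.trans (neg_lt_zero.2 Nat.one_div_pos_of_nat), hA⟩
    · rintro ⟨hx, hA⟩
      have h1 : 0 < -f x := neg_pos.2 hx
      obtain ⟨k, hk⟩ := exists_nat_one_div_lt h1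
      exact ⟨k, by change f x < _; linarith, hA⟩
  have h1 := tendsto_measure_iUnion_atTop (μ := (volume : Measure (Euc N))) hmono
  rw [hU] at h1
  refine (ENNReal.tendsto_toReal ?_).comp h1
  exact ((measure_mono fun x hx => le_of_lt (α := ℝ) hx.1).trans_lt hK.measure_lt_top).ne

lemma IsIpNorm.exists_ball_nearest (hH : IsIpNorm p H) (x₀ : Euc N) {δ : ℝ} (hδ : 0 < δ) :
    ∃ η > 0, ∀ y ∈ Metric.ball x₀ η, ∀ x, dualNorm H (x - y) ≤ dualNorm H (x₀ - y) →
      x ∈ Metric.ball x₀ δ := by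
  obtain ⟨C, hC, hCH⟩ := hH.exists_dual_lower
  obtain ⟨D, hD, hDH⟩ := hH.exists_dual_upper
  refine ⟨δ / (C * D + 1), by positivity, fun y hy x hx => ?_⟩
  rw [Metric.mem_ball, dist_eq_norm] at hy ⊢
  rw [lt_div_iff₀ (by positivity)] at hy
  have h1 : ‖x - x₀‖ ≤ ‖x - y‖ + ‖y - x₀‖ := norm_sub_le_norm_sub_add_norm_sub x y x₀
  have h2 : ‖x - y‖ ≤ C * (D * ‖y - x₀‖) := by
    refine (hCH _).trans (mul_le_mul_of_nonneg_left (hx.trans ?_) hC.le)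
    rw [norm_sub_rev]; exact hDH _
  linarith

lemma IsIpNorm.shell_volume_le (hH : IsIpNorm p H) (hN : 2 ≤ N) (hf : ContDiff ℝ 2 f)
    (hK : IsCompact {x | f x ≤ 0}) (hg : ∀ x, f x = 0 → gradient f x ≠ 0)
    (hc : ∀ x, f x = 0 → anisoCurv H f x = c) (hc0 : 0 < c) {C : ℝ}
    (hC : ∀ x, f x ≤ 0 → |⟪gradient f x, x⟫| ≤ C * H (gradient f x))
    {r T : ℝ} (hT : 0 ≤ T) (hTr : T ≤ r) (hr : (N - 1 : ℕ) / c < r)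
    (hx₀ : f x₀ = 0) {U A : Set (Euc N)} (hU : MeasurableSet U)
    (hUT : ∀ x ∈ U, f x ≤ 0 → gradient f x ≠ 0 → ∀ t, 0 < t → t ≤ r →
      (∀ z, dualNorm H (z - (x + t • anisoNormal H f x)) < t → f z < 0) → t ≤ T)
    (hA : ∀ y ∈ A, ∀ x, dualNorm H (x - y) ≤ dualNorm H (x₀ - y) → x ∈ U) :
    ((N - 1 : ℕ) - (c - (N - 1 : ℕ) / r) * C) * (volume.real {x | f x < 0} +
      (1 - T / r) ^ N * volume.real ({x | f x < 0} ∩ A)) ≤ r * c * volume.real {x | f x < 0} := by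
  have hn0 : (0 : ℝ) < (N - 1 : ℕ) := by exact_mod_cast (by omega : 0 < N - 1)
  have hN0 : (0 : ℝ) < N := by exact_mod_cast (by omega : 0 < N)
  have hr0 : 0 < r := lt_trans (by positivity) hr
  have hTr1 : 0 ≤ 1 - T / r := by rw [sub_nonneg, div_le_one hr0]; exact hTr
  have hω : 0 < c - (N - 1 : ℕ) / r := by
    rw [div_lt_iff₀ hc0] at hr
    rw [sub_pos, div_lt_iff₀ hr0]; linarith
  set κ : ℝ := (N - 1 : ℕ) - (c - (N - 1 : ℕ) / r) * C with hκ
  rcases le_or_gt κ 0 with hκ0 | hκ0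
  · exact (mul_nonpos_of_nonpos_of_nonneg hκ0 (by positivity)).trans (by positivity)
  obtain ⟨ε₁, hε₁, hsh⟩ := hH.exists_shell hf hK hg hc hω
  have hlim := ((tendsto_volume_sublevel hK univ).add
    ((tendsto_volume_sublevel hK A).const_mul ((1 - T / r) ^ N))).const_mul κ
  simp only [inter_univ] at hlim
  refine le_of_tendsto hlim ?_
  filter_upwards [(tendsto_one_div_add_atTop_nhds_zero_nat (𝕜 := ℝ)).eventually_lt_const hε₁]
    with k hk
  have hε : 0 < 1 / ((k : ℝ) + 1) := Nat.one_div_pos_of_nat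
  set ε : ℝ := 1 / ((k : ℝ) + 1)
  have hsub : ∀ x, f x ∈ Icc (-ε) 0 → gradient f x ≠ 0 ∧
      |anisoCurv H f x - c| ≤ c - (N - 1 : ℕ) / r := fun x hx =>
    hsh x ⟨by linarith [hx.1], hx.2⟩
  obtain ⟨h1, h2⟩ := hH.mul_volume_le hN hf hK hε hr0 hT hTr (fun x hx => (hsub x hx).1)
    (fun x hx => by linarith [(abs_le.1 (hsub x hx).2).1]) hx₀ hU hUT hA
  have h3 := shell_integral_le hε hH hf hK (fun x hx => (hsub x hx).1) (fun x hx => (hsub x hx).2)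
    (fun x hx => hC x hx.2)
  rw [max_eq_left hc0.le, ← Nat.cast_one, ← Nat.cast_sub (by omega : 1 ≤ N), ← hκ] at h3
  set I := ∫ x in {x | f x ∈ Ioo (-ε) 0}, H (gradient f x)
  set J := ∫ x in {x | f x ∈ Ioo (-ε) 0} ∩ U, H (gradient f x)
  set v := volume.real {x | f x < -ε}
  set b := volume.real ({x | f x < -ε} ∩ A)
  set W := volume.real {x | f x < 0}
  set θ := (1 - T / r) ^ N with hθ
  have hθ0 : 0 ≤ θ := pow_nonneg hTr1 _
  have h4 : ε * (v + θ * b) ≤ r / N * I := by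
    have := mul_le_mul_of_nonneg_left h2 hθ0
    linarith
  have h5 : ε * (κ * (v + θ * b)) ≤ ε * (r * c * W) := by
    calc ε * (κ * (v + θ * b)) = κ * (ε * (v + θ * b)) := by ring
      _ ≤ κ * (r / N * I) := mul_le_mul_of_nonneg_left h4 hκ0.le
      _ = r / N * (κ * I) := by ring
      _ ≤ r / N * (c * (N * (ε * W))) := mul_le_mul_of_nonneg_left h3 (by positivity)
      _ = ε * (r * c * W) := by field_simp
  exact le_of_mul_le_mul_left h5 hε

/-- An anisotropic ball of radius `(N - 1) / c` touches the boundary from inside at every point. -/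
lemma IsIpNorm.inner_ball (hH : IsIpNorm p H) (hN : 2 ≤ N) (hf : ContDiff ℝ 2 f)
    (hK : IsCompact {x | f x ≤ 0}) (hg : ∀ x, f x = 0 → gradient f x ≠ 0)
    (hc : ∀ x, f x = 0 → anisoCurv H f x = c) (hc0 : 0 < c) (hx₀ : f x₀ = 0)
    (hcl : x₀ ∈ closure {x | f x < 0}) {r : ℝ} (hr : r = (N - 1 : ℕ) / c) {z : Euc N}
    (hz : dualNorm H (z - (x₀ + r • anisoNormal H f x₀)) < r) : f z < 0 := by
  by_contra! hfz
  have hn0 : (0 : ℝ) < (N - 1 : ℕ) := by exact_mod_cast (by omega : 0 < N - 1)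
  have hr0 : 0 < r := by rw [hr]; positivity
  obtain ⟨δ, hδ, hδz⟩ : ∃ δ > 0, ∀ x t, dist x x₀ < δ → dist t r < δ →
      dualNorm H (z - (x + t • anisoNormal H f x)) < t := by
    have h1 : ContinuousAt (fun q : Euc N × ℝ =>
        dualNorm H (z - (q.1 + q.2 • anisoNormal H f q.1)) - q.2) (x₀, r) := by
      have h2 : ContinuousAt (fun q : Euc N × ℝ => anisoNormal H f q.1) (x₀, r) :=
        ContinuousAt.comp (f := Prod.fst) (x := (x₀, r))
          (hH.anisoNormal_contDiffAt hf (hg x₀ hx₀)).continuousAt continuousAt_fst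
      exact (hH.dual_continuous.continuousAt.comp (continuousAt_const.sub
        (continuousAt_fst.add (continuousAt_snd.smul h2)))).sub continuousAt_snd
    have h3 := h1.eventually_lt_const (u := 0) (by simpa using hz)
    obtain ⟨δ, hδ, h⟩ := Metric.eventually_nhds_iff.1 h3
    refine ⟨δ, hδ, fun x t hx ht => ?_⟩
    have := h (y := (x, t)) (by rw [Prod.dist_eq]; exact max_lt hx ht)
    simpa using this
  obtain ⟨η, hη, hηb⟩ := hH.exists_ball_nearest x₀ hδ
  obtain ⟨C, -, hC⟩ := hH.exists_abs_inner_le hK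
  set τ : ℝ := min δ r / 4 with hτ
  have hτ0 : 0 < τ := by have := lt_min hδ hr0; positivity
  have hτδ : 4 * τ ≤ δ := by rw [hτ]; linarith [min_le_left δ r]
  have hτr : 4 * τ ≤ r := by rw [hτ]; linarith [min_le_right δ r]
  have hb : 0 < volume.real ({x | f x < 0} ∩ Metric.ball x₀ η) := by
    rw [measureReal_def, ENNReal.toReal_pos_iff]
    constructor
    · refine ((isOpen_lt hf.continuous continuous_const).inter Metric.isOpen_ball).measure_pos _ ?_
      obtain ⟨w, hw, hw'⟩ := mem_closure_iff.1 hcl _ Metric.isOpen_ball (Metric.mem_ball_self hη)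
      exact ⟨w, hw', hw⟩
    · exact (measure_mono fun x hx => le_of_lt (α := ℝ) hx.1).trans_lt hK.measure_lt_top
  have hmain : ∀ r' ∈ Ioo r (r + τ), ((N - 1 : ℕ) - (c - (N - 1 : ℕ) / r') * C) *
      (volume.real {x | f x < 0} + (1 - (r - 2 * τ) / r') ^ N *
        volume.real ({x | f x < 0} ∩ Metric.ball x₀ η)) ≤ r' * c * volume.real {x | f x < 0} := by
    intro r' hr'
    refine hH.shell_volume_le hN hf hK hg hc hc0 hC (by linarith) (by linarith [hr'.1])
      (hr ▸ hr'.1) hx₀ Metric.isOpen_ball.measurableSet (fun x hx _ _ t _ htr hzt => ?_) hηb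
    by_contra! ht
    have h1 := hδz x t hx (by
      rw [Real.dist_eq, abs_lt]
      constructor <;> linarith [hr'.2])
    linarith [hzt z h1]
  have hcont : ∀ a b : ℝ, ContinuousAt (fun r' : ℝ => ((N - 1 : ℕ) - (c - (N - 1 : ℕ) / r') * C) *
      (a + (1 - (r - 2 * τ) / r') ^ N * b) - r' * c * a) r := by
    intro a b
    have h1 : ContinuousAt (fun r' : ℝ => r'⁻¹) r := continuousAt_inv₀ hr0.ne'
    simp only [div_eq_mul_inv]
    fun_prop (disch := exact hr0.ne')
  have hle := le_of_tendsto (((hcont (volume.real {x | f x < 0})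
    (volume.real ({x | f x < 0} ∩ Metric.ball x₀ η))).tendsto).mono_left
      (nhdsWithin_le_nhds (s := Ioi r))) (by
    filter_upwards [Ioo_mem_nhdsGT (by linarith : r < r + τ)] with r' hr'
    exact sub_nonpos.2 (hmain r' hr'))
  have hrc : r * c = (N - 1 : ℕ) := by rw [hr]; field_simp
  have hcr : (N - 1 : ℕ) / r = c := by rw [hr]; field_simp
  rw [hrc, hcr, sub_self, zero_mul, sub_zero] at hle
  have hθ : 0 < (1 - (r - 2 * τ) / r) ^ N := by
    refine pow_pos ?_ _
    rw [sub_pos, div_lt_one hr0]; linarith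
  have := mul_pos hn0 (mul_pos hθ hb)
  linarith

end

section

variable {N : ℕ} {p : ℝ} {H f : Euc N → ℝ} {c : ℝ} {x₀ : Euc N}

lemma IsIpNorm.dual_smul (hH : IsIpNorm p H) {t : ℝ} (ht : 0 < t) (x : Euc N) :
    dualNorm H (t • x) = t * dualNorm H x := by
  refine le_antisymm (hH.dual_smul_le ht.le x) ?_
  have h := hH.dual_smul_le (inv_pos.2 ht).le (t • x)
  rwa [inv_smul_smul₀ ht.ne', ← div_eq_inv_mul, le_div_iff₀' ht] at h

/-- A map whose derivative vanishes in the directions tangent to a regular level set is locally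
constant on that level set. -/
lemma eventually_eq_of_tangential_fderiv_eq_zero {F : Type*} [NormedAddCommGroup F]
    [NormedSpace ℝ F] (hf : ContDiff ℝ 1 f) (hx₀ : f x₀ = 0) (hg : gradient f x₀ ≠ 0)
    {Y : Euc N → F} (hY : ∀ x, f x = 0 → DifferentiableAt ℝ Y x)
    (hY0 : ∀ x, f x = 0 → ∀ v, ⟪gradient f x, v⟫ = 0 → fderiv ℝ Y x v = 0) :
    ∀ᶠ x in 𝓝 x₀, f x = 0 → Y x = Y x₀ := by
  set g := gradient f x₀ with hgdef
  have hgn : ‖g‖ ^ 2 ≠ 0 := pow_ne_zero _ (norm_ne_zero_iff.2 hg)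
  set Φ : Euc N → Euc N := fun x => x + ((f x - ⟪g, x⟫) / ‖g‖ ^ 2) • g with hΦ
  have hΦc : ContDiff ℝ 1 Φ :=
    contDiff_id.add (((hf.sub (contDiff_const.inner ℝ contDiff_id)).div_const _).smul
      contDiff_const)
  have hΦg : ∀ x, ⟪g, Φ x⟫ = f x := fun x => by
    rw [hΦ]
    simp only [inner_add_right, inner_smul_right, real_inner_self_eq_norm_sq]
    field_simp
    ring
  have hΦd : HasFDerivAt Φ ((ContinuousLinearEquiv.refl ℝ (Euc N) : Euc N ≃L[ℝ] Euc N) :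
      Euc N →L[ℝ] Euc N) x₀ := by
    have h1 : HasFDerivAt f (innerSL ℝ g) x₀ :=
      ((hf.differentiable (by norm_num)) x₀).hasGradientAt.hasFDerivAt
    have h2 : HasFDerivAt (fun x : Euc N => ⟪g, x⟫) (innerSL ℝ g) x₀ :=
      (innerSL ℝ g).hasFDerivAt
    have h3 := (hasFDerivAt_id x₀).add
      ((((h1.sub h2).mul_const (‖g‖ ^ 2)⁻¹)).smul_const g)
    refine (h3.congr_fderiv ?_)
    ext v
    simp
  set e := hΦc.contDiffAt.toOpenPartialHomeomorph Φ hΦd (by norm_num) with he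
  have heΦ : ⇑e = Φ := ContDiffAt.toOpenPartialHomeomorph_coe _ hΦd _
  have hx₀s : x₀ ∈ e.source := hΦc.contDiffAt.mem_toOpenPartialHomeomorph_source hΦd (by norm_num)
  have hφ : ContDiffAt ℝ 1 e.symm (Φ x₀) := hΦc.contDiffAt.to_localInverse hΦd (by norm_num)
  have htar : e.target ∈ 𝓝 (Φ x₀) := by
    rw [← heΦ]; exact e.open_target.mem_nhds (e.map_source hx₀s)
  obtain ⟨ρ, hρ, hball⟩ := Metric.eventually_nhds_iff_ball.1
    ((hφ.eventually (by norm_num)).and htar)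
  filter_upwards [e.open_source.mem_nhds hx₀s,
    hΦc.continuous.continuousAt.preimage_mem_nhds (Metric.ball_mem_nhds (Φ x₀) hρ)]
    with x hxs hxb hx
  set w : ℝ → Euc N := fun τ => Φ x₀ + τ • (Φ x - Φ x₀) with hw
  have hwd : ∀ τ, HasDerivAt w (Φ x - Φ x₀) τ := fun τ => by
    have h := ((hasDerivAt_id τ).smul_const (Φ x - Φ x₀)).const_add (Φ x₀)
    rw [one_smul] at h
    exact h
  have hwb : ∀ τ ∈ Icc (0 : ℝ) 1, w τ ∈ Metric.ball (Φ x₀) ρ := fun τ hτ =>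
    (convex_ball (Φ x₀) ρ).add_smul_sub_mem (Metric.mem_ball_self hρ) hxb hτ
  have hwg : ∀ τ, ⟪g, w τ⟫ = 0 := fun τ => by
    simp only [hw, inner_add_right, inner_smul_right, inner_sub_right, hΦg, hx, hx₀]; simp
  have hf0 : ∀ τ ∈ Icc (0 : ℝ) 1, f (e.symm (w τ)) = 0 := fun τ hτ => by
    rw [← hΦg, ← heΦ, e.right_inv (hball _ (hwb τ hτ)).2, hwg]
  have hγ : ∀ τ ∈ Icc (0 : ℝ) 1, HasDerivAt (fun τ => e.symm (w τ))
      (fderiv ℝ e.symm (w τ) (Φ x - Φ x₀)) τ := fun τ hτ =>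
    (((hball _ (hwb τ hτ)).1.differentiableAt (by norm_num)).hasFDerivAt).comp_hasDerivAt τ (hwd τ)
  have hder : ∀ τ ∈ Icc (0 : ℝ) 1, HasDerivAt (fun τ => Y (e.symm (w τ))) 0 τ := by
    intro τ hτ
    have h1 := ((hY _ (hf0 τ hτ)).hasFDerivAt).comp_hasDerivAt τ (hγ τ hτ)
    rw [hY0 _ (hf0 τ hτ)] at h1
    · exact h1
    have h2 : HasDerivAt (fun τ => f (e.symm (w τ)))
        (fderiv ℝ f (e.symm (w τ)) (fderiv ℝ e.symm (w τ) (Φ x - Φ x₀))) τ :=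
      (((hf.differentiable (by norm_num)) _).hasFDerivAt).comp_hasDerivAt τ (hγ τ hτ)
    have h3 : (fun τ => f (e.symm (w τ))) =ᶠ[𝓝 τ] fun _ => 0 := by
      filter_upwards [(hwd τ).continuousAt.preimage_mem_nhds
        (Metric.isOpen_ball.mem_nhds (hwb τ hτ))] with σ hσ
      rw [← hΦg, ← heΦ, e.right_inv (hball _ hσ).2, hwg]
    rw [gradient_inner_eq]
    exact h2.unique ((hasDerivAt_const τ (0 : ℝ)).congr_of_eventuallyEq h3)
  have hend := constant_of_has_deriv_right_zero
    (fun τ hτ => (hder τ hτ).continuousAt.continuousWithinAt)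
    (fun τ hτ => (hder τ (Ico_subset_Icc_self hτ)).hasDerivWithinAt) 1 (by norm_num)
  have h0 : w 0 = e x₀ := by simp [hw, heΦ]
  have h1 : w 1 = e x := by simp [hw, heΦ]
  simpa only [h0, h1, e.left_inv hxs, e.left_inv hx₀s] using hend

lemma IsIpNorm.center_eq_of_connected (hH : IsIpNorm p H) (hN : 2 ≤ N) (hp : 1 < p)
    (hf : ContDiff ℝ 2 f) (hg : ∀ x, f x = 0 → gradient f x ≠ 0)
    (hc : ∀ x, f x = 0 → anisoCurv H f x = c) (hc0 : 0 < c) {r : ℝ} (hr : r = (N - 1 : ℕ) / c)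
    (hball : ∀ x, f x = 0 → ∀ z, dualNorm H (z - (x + r • anisoNormal H f x)) < r → f z < 0)
    (hconn : IsPreconnected {x | f x = 0}) {x y : Euc N} (hx : f x = 0) (hy : f y = 0) :
    x + r • anisoNormal H f x = y + r • anisoNormal H f y := by
  have hn0 : (0 : ℝ) < (N - 1 : ℕ) := by exact_mod_cast (by omega : 0 < N - 1)
  have hr0 : 0 < r := by rw [hr]; positivity
  set Y : Euc N → Euc N := fun x => x + r • anisoNormal H f x
  have hZ : ∀ x, f x = 0 → DifferentiableAt ℝ (anisoNormal H f) x := fun x hx =>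
    (hH.anisoNormal_contDiffAt hf (hg x hx)).differentiableAt (by norm_num)
  have htouch : ∀ x, f x = 0 → TouchesAt H f x (Y x) r := by
    intro x hx
    refine ⟨hr0, ?_, fun z hz => hx ▸ (hball x hx z hz).le, hg x hx⟩
    have h1 : x - Y x = -(r • anisoNormal H f x) := by simp [Y]
    rw [h1, hH.dual_neg, hH.dual_smul hr0, hH.dual_anisoNormal (hg x hx), mul_one]
  have hYd : ∀ x, f x = 0 → HasFDerivAt Y (.id ℝ _ + r • fderiv ℝ (anisoNormal H f) x) x :=
    fun x hx => (hasFDerivAt_id x).add ((hZ x hx).hasFDerivAt.const_smul r)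
  have hloc : ∀ x, f x = 0 → ∀ᶠ z in 𝓝 x, f z = 0 → Y z = Y x := fun x hx =>
    eventually_eq_of_tangential_fderiv_eq_zero (hf.of_le (by norm_num)) hx (hg x hx)
      (fun x hx => (hYd x hx).differentiableAt) fun x hx v hv => by
        rw [(hYd x hx).fderiv]
        refine (htouch x hx).add_smul_fderiv_eq_zero hH hp hf ?_ hv
        rw [hc x hx, hr, div_mul_cancel₀ _ hc0.ne', Nat.cast_sub (by omega), Nat.cast_one]
  have := Subtype.preconnectedSpace hconn
  have hlc : IsLocallyConstant fun x : {x | f x = 0} => Y x := by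
    rw [IsLocallyConstant.iff_eventually_eq]
    intro x
    filter_upwards [continuousAt_subtype_val.eventually (hloc x x.2)] with z hz
    exact hz z.2
  exact hlc.apply_eq_of_preconnectedSpace ⟨x, hx⟩ ⟨y, hy⟩

lemma IsIpNorm.eq_dual_ball (hH : IsIpNorm p H) (hf : Continuous f)
    (hK : IsCompact {x | f x ≤ 0}) {r : ℝ} (hr : 0 < r) {y : Euc N}
    (hsph : ∀ x, f x = 0 → dualNorm H (x - y) = r)
    (hball : ∀ z, dualNorm H (z - y) < r → f z < 0) :
    {x | f x < 0} = {x | dualNorm H (x - y) < r} := by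
  refine Subset.antisymm (fun z hz => ?_) hball
  by_contra hzr
  replace hzr : r ≤ dualNorm H (z - y) := not_lt.1 hzr
  replace hz : f z < 0 := hz
  have hzy : z - y ≠ 0 := by
    intro h
    rw [h, IsIpNorm.dual_zero] at hzr
    linarith
  have hpos : 0 < ‖z - y‖ := norm_pos_iff.2 hzy
  obtain ⟨R, hR, hRK⟩ := hK.isBounded.exists_pos_norm_le
  set S : ℝ := 1 + (R + ‖y‖) / ‖z - y‖ with hS
  have hS1 : 1 ≤ S := by rw [hS]; linarith [show 0 ≤ (R + ‖y‖) / ‖z - y‖ by positivity]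
  have hfS : 0 < f (y + S • (z - y)) := by
    by_contra! h
    have h1 := hRK _ h
    have h2 : ‖S • (z - y)‖ ≤ ‖y + S • (z - y)‖ + ‖y‖ := by
      simpa using norm_sub_le (y + S • (z - y)) y
    rw [norm_smul, Real.norm_of_nonneg (by linarith), hS, add_mul, one_mul,
      div_mul_cancel₀ _ hpos.ne'] at h2
    linarith
  have hc : ContinuousOn (fun s : ℝ => f (y + s • (z - y))) (Icc 1 S) :=
    (hf.comp (by fun_prop)).continuousOn
  obtain ⟨s, hs, hs0⟩ := intermediate_value_Icc hS1 hc
    (show (0 : ℝ) ∈ Icc _ _ from ⟨by simpa using hz.le, hfS.le⟩)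
  have hs1 : 1 < s := by
    refine lt_of_le_of_ne hs.1 fun h => ?_
    rw [← h] at hs0
    simp at hs0
    linarith
  have h1 := hsph _ hs0
  rw [add_sub_cancel_left, hH.dual_smul (by linarith)] at h1
  nlinarith

end

/-- anisotropic Alexandrov theorem. -/
theorem anisotropic_alexandrov
    {N : ℕ} (hN : 2 ≤ N) {p : ℝ} (hp : 1 < p)
    {H : Euc N → ℝ} (hH : IsIpNorm p H)
    {Ω : Set (Euc N)} (hΩo : IsOpen Ω) (hΩconn : IsConnected Ω)
    (hΩbd : Bornology.IsBounded Ω) (hfr : IsConnected (frontier Ω))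
    {ν : Euc N → Euc N} {M : Euc N → ℝ} (hνM : IsNormalCurv H Ω ν M)
    {c : ℝ} (hconst : ∀ x ∈ frontier Ω, M x = c) :
    IsWulffShape H Ω := by
  obtain ⟨f, hf, rfl, hfr0, hg, -, hM⟩ := hνM
  have hmem : ∀ x, x ∈ frontier {x | f x < 0} ↔ f x = 0 := fun x => by rw [hfr0]; rfl
  have hcl : closure {x | f x < 0} = {x | f x ≤ 0} := by
    rw [closure_eq_self_union_frontier, hfr0]
    ext x
    exact (le_iff_lt_or_eq (a := f x) (b := 0)).symm
  have hK : IsCompact {x | f x ≤ 0} := hcl ▸ hΩbd.isCompact_closure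
  have hg0 : ∀ x, f x = 0 → gradient f x ≠ 0 := fun x hx => hg x ((hmem x).2 hx)
  have hc : ∀ x, f x = 0 → anisoCurv H f x = c := fun x hx => by
    rw [← hconst x ((hmem x).2 hx), hM x ((hmem x).2 hx)]
    rfl
  have hxcl : ∀ x, f x = 0 → x ∈ closure {x | f x < 0} := fun x hx =>
    frontier_subset_closure ((hmem x).2 hx)
  obtain ⟨x₀, hx₀⟩ := hfr.nonempty
  rw [hmem] at hx₀
  have hc0 := hH.curv_pos hN hf hK hg0 hc hx₀ (hxcl x₀ hx₀)
  have hn0 : (0 : ℝ) < (N - 1 : ℕ) := by exact_mod_cast (by omega : 0 < N - 1)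
  set r : ℝ := (N - 1 : ℕ) / c with hr
  have hr0 : 0 < r := by positivity
  have hball : ∀ x, f x = 0 → ∀ z, dualNorm H (z - (x + r • anisoNormal H f x)) < r → f z < 0 :=
    fun x hx z hz => hH.inner_ball hN hf hK hg0 hc hc0 hx (hxcl x hx) hr hz
  have hcenter : ∀ x, f x = 0 →
      x + r • anisoNormal H f x = x₀ + r • anisoNormal H f x₀ := fun x hx =>
    hH.center_eq_of_connected hN hp hf hg0 hc hc0 hr hball (hfr0 ▸ hfr.isPreconnected) hx hx₀
  refine ⟨x₀ + r • anisoNormal H f x₀, r, hr0,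
    hH.eq_dual_ball hf.continuous hK hr0 (fun x hx => ?_) (hball x₀ hx₀)⟩
  rw [← hcenter x hx, sub_add_cancel_left, hH.dual_neg, hH.dual_smul hr0,
    hH.dual_anisoNormal (hg0 x hx), mul_one]

end
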